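/- arXiv:math/0702444 — 2 statements merged into one kernel-verified Lean document; each statement's English description precedes it below -/
import Mathlib

section
/- Let K be a field of characteristic zero and A a graded Artinian Gorenstein K-algebra. Then A has the SLP if and only if there exists a linear form z ∈ A_1 such that every central simple module U_i of (A, z) (for i = 1, ..., s) has the SLP. -/
set_option maxHeartbeats 1000000
set_option synthInstance.maxHeartbeats 400000

open TensorProduct

section LefschetzPrelude

variable (K : Type) [Field K]

/-- `𝒜` makes `A` into a graded Artinian `K`-algebra (with possibly non-standard
grading): `A` is the internal direct sum of the `𝒜 i`, the grading is
multiplicative, `A₀ = K·1` and `A` is finite dimensional over `K`. -/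
def IsGradedArtinAlg {A : Type} [CommRing A] [Algebra K A]
    (𝒜 : ℕ → Submodule K A) : Prop :=
  DirectSum.IsInternal 𝒜 ∧
  (1 : A) ∈ 𝒜 0 ∧
  (∀ i j : ℕ, ∀ x ∈ 𝒜 i, ∀ y ∈ 𝒜 j, x * y ∈ 𝒜 (i + j)) ∧
  𝒜 0 = Submodule.span K {(1 : A)} ∧
  FiniteDimensional K A

/-- `c` is the top degree of the grading `𝒜`. -/
def GradedTop {A : Type} [CommRing A] [Algebra K A]
    (𝒜 : ℕ → Submodule K A) (c : ℕ) : Prop :=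
  𝒜 c ≠ ⊥ ∧ ∀ i : ℕ, c < i → 𝒜 i = ⊥

/-- `ℳ` makes the `A`-module `V` into a finite graded module over the graded
algebra `(A, 𝒜)`. -/
def IsGradedMod {A V : Type} [CommRing A] [Algebra K A] [AddCommGroup V]
    [Module K V] [Module A V] [IsScalarTower K A V]
    (𝒜 : ℕ → Submodule K A) (ℳ : ℤ → Submodule K V) : Prop :=
  DirectSum.IsInternal ℳ ∧
  (∀ (i : ℕ) (j : ℤ), ∀ a ∈ 𝒜 i, ∀ v ∈ ℳ j, a • v ∈ ℳ (j + i)) ∧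
  FiniteDimensional K V

/-- The graded pieces of `ℳ` are supported exactly between degrees `a` and `b`. -/
def GradedBetween {V : Type} [AddCommGroup V] [Module K V]
    (ℳ : ℤ → Submodule K V) (a b : ℤ) : Prop :=
  a ≤ b ∧ ℳ a ≠ ⊥ ∧ ℳ b ≠ ⊥ ∧ ∀ i : ℤ, i < a ∨ b < i → ℳ i = ⊥

/-- Multiplication by `g : A` on the `A`-module `V`, as a `K`-linear endomorphism. -/
noncomputable def mulMap {A : Type} (V : Type) [CommRing A] [Algebra K A] [AddCommGroup V]
    [Module K V] [Module A V] [IsScalarTower K A V] (g : A) : Module.End K V :=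
  (LinearMap.lsmul A V g).restrictScalars K

/-- The endomorphism `f` of the graded vector space `ℳ` (supported between
degrees `a` and `b`) is a weak Lefschetz operator: each `f : ℳ i → ℳ (i+1)` is
injective or surjective. -/
def IsWLEndo {V : Type} [AddCommGroup V] [Module K V]
    (ℳ : ℤ → Submodule K V) (a b : ℤ) (f : Module.End K V) : Prop :=
  ∀ i : ℤ, a ≤ i → i + 1 ≤ b →
    ((∀ v ∈ ℳ i, f v = 0 → v = 0) ∨ (∀ w ∈ ℳ (i + 1), ∃ v ∈ ℳ i, f v = w))

/-- The endomorphism `f` of the graded vector space `ℳ` (supported between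
degrees `a` and `b`) is a strong Lefschetz operator:
`f^(b-a-2i) : ℳ (a+i) → ℳ (b-i)` is bijective for all `0 ≤ 2i ≤ b-a`. -/
def IsSLEndo {V : Type} [AddCommGroup V] [Module K V]
    (ℳ : ℤ → Submodule K V) (a b : ℤ) (f : Module.End K V) : Prop :=
  ∀ i : ℕ, 2 * (i : ℤ) ≤ b - a →
    (∀ v ∈ ℳ (a + i), (f ^ (b - a - 2 * i).toNat) v = 0 → v = 0) ∧
    (∀ w ∈ ℳ (b - i), ∃ v ∈ ℳ (a + i), (f ^ (b - a - 2 * i).toNat) v = w)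

/-- `g ∈ A₁` is a weak Lefschetz element for the graded module `(V, ℳ)`. -/
def IsWLElem {A V : Type} [CommRing A] [Algebra K A] [AddCommGroup V]
    [Module K V] [Module A V] [IsScalarTower K A V]
    (𝒜 : ℕ → Submodule K A) (ℳ : ℤ → Submodule K V) (a b : ℤ) (g : A) : Prop :=
  g ∈ 𝒜 1 ∧ IsWLEndo K ℳ a b (mulMap K V g)

/-- `g ∈ A₁` is a strong Lefschetz element for the graded module `(V, ℳ)`. -/
def IsSLElem {A V : Type} [CommRing A] [Algebra K A] [AddCommGroup V]
    [Module K V] [Module A V] [IsScalarTower K A V]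
    (𝒜 : ℕ → Submodule K A) (ℳ : ℤ → Submodule K V) (a b : ℤ) (g : A) : Prop :=
  g ∈ 𝒜 1 ∧ IsSLEndo K ℳ a b (mulMap K V g)

/-- The Hilbert function of the graded vector space `ℳ`. -/
noncomputable def hilb {V : Type} [AddCommGroup V] [Module K V]
    (ℳ : ℤ → Submodule K V) (i : ℤ) : ℕ :=
  Module.finrank K (ℳ i)

/-- The Hilbert function of `ℳ`, supported between `a` and `b`, is symmetric. -/
def SymHilb {V : Type} [AddCommGroup V] [Module K V]
    (ℳ : ℤ → Submodule K V) (a b : ℤ) : Prop :=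
  ∀ i : ℤ, hilb K ℳ (a + i) = hilb K ℳ (b - i)

/-- The Hilbert function of `ℳ`, supported between `a` and `b`, is unimodal. -/
def UnimodalHilb {V : Type} [AddCommGroup V] [Module K V]
    (ℳ : ℤ → Submodule K V) (a b : ℤ) : Prop :=
  ∃ m : ℤ, a ≤ m ∧ m ≤ b ∧
    (∀ i j : ℤ, a ≤ i → i ≤ j → j ≤ m → hilb K ℳ i ≤ hilb K ℳ j) ∧
    (∀ i j : ℤ, m ≤ i → i ≤ j → j ≤ b → hilb K ℳ j ≤ hilb K ℳ i)

/-- The Sperner number of `ℳ` (supported between `a` and `b`). -/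
noncomputable def sperner {V : Type} [AddCommGroup V] [Module K V]
    (ℳ : ℤ → Submodule K V) (a b : ℤ) : ℕ :=
  (Finset.Icc a b).sup fun i => hilb K ℳ i

/-- The CoSperner number of `ℳ` (supported between `a` and `b`). -/
noncomputable def coSperner {V : Type} [AddCommGroup V] [Module K V]
    (ℳ : ℤ → Submodule K V) (a b : ℤ) : ℕ :=
  ∑ i ∈ Finset.Icc a (b - 1), min (hilb K ℳ i) (hilb K ℳ (i + 1))

/-- `SP_k(V) = Σ_{i=a}^{b} max (dim V_i - dim V_{i-k}) 0` (via truncated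
subtraction on `ℕ`). -/
noncomputable def spernerVec {V : Type} [AddCommGroup V] [Module K V]
    (ℳ : ℤ → Submodule K V) (a b : ℤ) (k : ℕ) : ℕ :=
  ∑ i ∈ Finset.Icc a b, (hilb K ℳ i - hilb K ℳ (i - (k : ℤ)))

/-- `d` is the multiset of Jordan block sizes of the (nilpotent) endomorphism `f`:
all entries are positive and `dim ker f^k = Σ_{n ∈ d} min n k` for every `k`. -/
def IsJordanType {V : Type} [AddCommGroup V] [Module K V]
    (f : Module.End K V) (d : Multiset ℕ) : Prop :=
  (∀ n ∈ d, 0 < n) ∧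
  ∀ k : ℕ, Module.finrank K (LinearMap.ker (f ^ k)) = (d.map fun n => min n k).sum

/-- `g ∈ A₁` is a weak Lefschetz element of the graded algebra `(A, 𝒜)` with top
degree `c`. -/
def IsAlgWLElem {A : Type} [CommRing A] [Algebra K A]
    (𝒜 : ℕ → Submodule K A) (c : ℕ) (g : A) : Prop :=
  g ∈ 𝒜 1 ∧ ∀ i : ℕ, i + 1 ≤ c →
    ((∀ v ∈ 𝒜 i, g * v = 0 → v = 0) ∨ (∀ w ∈ 𝒜 (i + 1), ∃ v ∈ 𝒜 i, g * v = w))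

/-- `g ∈ A₁` is a strong Lefschetz element of the graded algebra `(A, 𝒜)` with top
degree `c`: `×g^(c-2i) : A_i → A_{c-i}` is bijective for `0 ≤ 2i ≤ c`. -/
def IsAlgSLElem {A : Type} [CommRing A] [Algebra K A]
    (𝒜 : ℕ → Submodule K A) (c : ℕ) (g : A) : Prop :=
  g ∈ 𝒜 1 ∧ ∀ i : ℕ, 2 * i ≤ c →
    (∀ v ∈ 𝒜 i, g ^ (c - 2 * i) * v = 0 → v = 0) ∧
    (∀ w ∈ 𝒜 (c - i), ∃ v ∈ 𝒜 i, g ^ (c - 2 * i) * v = w)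

/-- The graded algebra `(A, 𝒜)` has the weak Lefschetz property. -/
def AlgHasWLP {A : Type} [CommRing A] [Algebra K A] (𝒜 : ℕ → Submodule K A) : Prop :=
  ∃ c : ℕ, GradedTop K 𝒜 c ∧ ∃ g : A, IsAlgWLElem K 𝒜 c g

/-- The graded algebra `(A, 𝒜)` has the strong Lefschetz property. -/
def AlgHasSLP {A : Type} [CommRing A] [Algebra K A] (𝒜 : ℕ → Submodule K A) : Prop :=
  ∃ c : ℕ, GradedTop K 𝒜 c ∧ ∃ g : A, IsAlgSLElem K 𝒜 c g

/-- The graded pieces of the tensor product `V ⊗[K] W` of two graded vector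
spaces: `(ℳ ⊗ 𝒩)_k = Σ_{i+j=k} ℳ_i ⊗ 𝒩_j`. -/
noncomputable def tensorGrading {V W : Type} [AddCommGroup V] [Module K V]
    [AddCommGroup W] [Module K W] (ℳ : ℤ → Submodule K V) (𝒩 : ℤ → Submodule K W)
    (k : ℤ) : Submodule K (V ⊗[K] W) :=
  ⨆ i : ℤ, LinearMap.range (TensorProduct.map (ℳ i).subtype (𝒩 (k - i)).subtype)

/-- Reindex a `ℕ`-indexed grading by `ℤ`. -/
noncomputable def natToZ {V : Type} [AddCommGroup V] [Module K V]
    (ℒ : ℕ → Submodule K V) (i : ℤ) : Submodule K V :=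
  if 0 ≤ i then ℒ i.toNat else ⊥

/-- The truncated polynomial ring `K[t]/(t^α)`. -/
abbrev TruncPoly (α : ℕ) : Type :=
  Polynomial K ⧸ Ideal.span {(Polynomial.X : Polynomial K) ^ α}

/-- The image of `t` in `K[t]/(t^α)`. -/
noncomputable def tbar (α : ℕ) : TruncPoly K α :=
  Ideal.Quotient.mk _ Polynomial.X

/-- The standard grading of `K[t]/(t^α)` (with `deg t = 1`): the degree-`j` piece
is spanned by the class of `t^j` for `0 ≤ j < α`, and is zero otherwise. -/
noncomputable def truncGrading (α : ℕ) (j : ℤ) : Submodule K (TruncPoly K α) :=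
  if 0 ≤ j ∧ j < (α : ℤ) then Submodule.span K {tbar K α ^ j.toNat} else ⊥

end LefschetzPrelude

section CentralSimple

variable (K : Type) [Field K]

/-- The ideal `(0 :_A z^m) + zA` of `A`. -/
noncomputable def colonPlus {A : Type} [CommRing A] [Algebra K A] (z : A) (m : ℕ) : Ideal A :=
  LinearMap.ker (LinearMap.lsmul A A (z ^ m)) ⊔ Ideal.span {z}

/-- The subquotient `((0 :_A z^m) + zA) / ((0 :_A z^m') + zA)` of `A`, as an
`A`-module.  For `m = f_i`, `m' = f_{i+1}` consecutive distinct Jordan block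
sizes of `×z`, this is the `i`-th central simple module of `(A, z)`. -/
abbrev CSMod {A : Type} [CommRing A] [Algebra K A] (z : A) (m m' : ℕ) : Type :=
  ↥(colonPlus K z m) ⧸
    Submodule.comap (colonPlus K z m).subtype (colonPlus K z m')

/-- The degree-`d` graded piece of the central simple module `CSMod z m m'`:
the image of `((0 :_A z^m) + zA) ∩ A_d`. -/
noncomputable def csGrading {A : Type} [CommRing A] [Algebra K A]
    (𝒜 : ℕ → Submodule K A) (z : A) (m m' : ℕ) (d : ℕ) :
    Submodule K (CSMod K z m m') :=
  Submodule.map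
    ((Submodule.comap (colonPlus K z m).subtype (colonPlus K z m')).mkQ.restrictScalars K)
    (Submodule.comap ((colonPlus K z m).subtype.restrictScalars K) (𝒜 d))

/-- `f : Fin s → ℕ` enumerates, in strictly decreasing order, the distinct entries
of the multiset `d`. -/
def DistinctSizes (d : Multiset ℕ) {s : ℕ} (f : Fin s → ℕ) : Prop :=
  StrictAnti f ∧ ∀ n : ℕ, (∃ i, f i = n) ↔ n ∈ d

/-- The successor value `f_{i+1}`, with the convention `f_{s+1} = 0`. -/
def nextSize {s : ℕ} (f : Fin s → ℕ) (i : Fin s) : ℕ :=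
  if h : (i : ℕ) + 1 < s then f ⟨(i : ℕ) + 1, h⟩ else 0

/-- The graded vector space `ℒ` has a symmetric Hilbert function with
reflecting degree `c/2`, i.e. its support is an interval `[a, b]` with
`a + b = c` and `dim ℒ_{a+j} = dim ℒ_{b-j}` for all `j`. -/
def SymAround {V : Type} [AddCommGroup V] [Module K V]
    (ℒ : ℤ → Submodule K V) (c : ℤ) : Prop :=
  ∃ a b : ℤ, GradedBetween K ℒ a b ∧ a + b = c ∧ SymHilb K ℒ a b

/-- The graded `A`-module with pieces `ℒ` has the strong Lefschetz property:
some linear form `g ∈ A₁` is a strong Lefschetz element between the (exact)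
bounds of the support of `ℒ`. -/
def PiecesHasSLP {A V : Type} [CommRing A] [Algebra K A] [AddCommGroup V]
    [Module K V] [Module A V] [IsScalarTower K A V]
    (𝒜 : ℕ → Submodule K A) (ℒ : ℤ → Submodule K V) : Prop :=
  ∃ a b : ℤ, GradedBetween K ℒ a b ∧
    ∃ g ∈ 𝒜 1, IsSLEndo K ℒ a b (mulMap K V g)

/-- The graded vector space `ℒ` has a symmetric Hilbert function. -/
def SymHilbSome {V : Type} [AddCommGroup V] [Module K V]
    (ℒ : ℤ → Submodule K V) : Prop :=
  ∃ a b : ℤ, GradedBetween K ℒ a b ∧ SymHilb K ℒ a b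

/-- The graded algebra `(A, 𝒜)` (with graded maximal ideal `m = ⊕_{i≥1} A_i`)
is Gorenstein: the socle `0 :_A m` is one dimensional over `K`. -/
def IsGorenstein {A : Type} [CommRing A] [Algebra K A]
    (𝒜 : ℕ → Submodule K A) : Prop :=
  ∃ x : A, x ≠ 0 ∧ (∀ i : ℕ, 1 ≤ i → ∀ y ∈ 𝒜 i, x * y = 0) ∧
    ∀ x' : A, (∀ i : ℕ, 1 ≤ i → ∀ y ∈ 𝒜 i, x' * y = 0) → ∃ c : K, x' = c • x

end CentralSimple

/-- If a polynomial family of linear maps between spaces of equal dimension fails to be injective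
for infinitely many parameters, then it kills a nonzero polynomial vector. -/
theorem exists_polynomial_kernel {K V W : Type} [Field K] [AddCommGroup V] [Module K V]
    [AddCommGroup W] [Module K W] [FiniteDimensional K V] [FiniteDimensional K W]
    (hVW : Module.finrank K V = Module.finrank K W) (T : ℕ → V →ₗ[K] W) (N : ℕ)
    (hinf : {t : K | ∃ v, v ≠ 0 ∧ ∑ k ∈ Finset.range N, t ^ k • T k v = 0}.Infinite) :
    ∃ (v : ℤ → V) (M : ℤ), (∀ j < 0, v j = 0) ∧ (∀ j, M ≤ j → v j = 0) ∧ (∃ j, v j ≠ 0) ∧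
      ∀ j : ℤ, ∑ k ∈ Finset.range N, T k (v (j - k)) = 0 := by
  classical
  let b := Module.finBasis K V
  let b' := Module.finBasisOfFinrankEq K W hVW.symm
  let B : Matrix (Fin (Module.finrank K V)) (Fin (Module.finrank K V)) (Polynomial K) :=
    fun p q => ∑ k ∈ Finset.range N,
      Polynomial.C (LinearMap.toMatrix b b' (T k) p q) * Polynomial.X ^ k
  have heval : ∀ t : K, (Polynomial.evalRingHom t).mapMatrix B =
      LinearMap.toMatrix b b' (∑ k ∈ Finset.range N, t ^ k • T k) := by
    intro t
    ext p q
    change Polynomial.eval t (∑ k ∈ Finset.range N,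
      Polynomial.C (LinearMap.toMatrix b b' (T k) p q) * Polynomial.X ^ k) = _
    simp only [Polynomial.eval_finsetSum, map_sum, map_smul, Matrix.sum_apply, Matrix.smul_apply,
      Polynomial.eval_mul, Polynomial.eval_C, Polynomial.eval_pow, Polynomial.eval_X, smul_eq_mul]
    exact Finset.sum_congr rfl fun k _ => mul_comm _ _
  have hdet : B.det = 0 := by
    apply Polynomial.eq_zero_of_infinite_isRoot
    refine hinf.mono ?_
    rintro t ⟨v, hv0, hv⟩
    change Polynomial.eval t B.det = 0
    rw [← Polynomial.coe_evalRingHom, RingHom.map_det, heval,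
      ← Matrix.exists_mulVec_eq_zero_iff]
    refine ⟨b.repr v, ?_, ?_⟩
    · intro h
      apply hv0
      apply b.repr.injective
      ext x
      simpa using congrFun h x
    · rw [LinearMap.toMatrix_mulVec_repr]
      have : (∑ k ∈ Finset.range N, t ^ k • T k) v = 0 := by
        simpa [LinearMap.sum_apply] using hv
      rw [this]
      simp
  obtain ⟨w, hw0, hw⟩ := Matrix.exists_mulVec_eq_zero_iff.mpr hdet
  refine ⟨fun j => ∑ m, (if 0 ≤ j then (w m).coeff j.toNat else 0) • b m,
    ((Finset.univ.sup fun m => (w m).natDegree) : ℕ) + 1, ?_, ?_, ?_, ?_⟩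
  · intro j hj
    simp [not_le.mpr hj]
  · intro j hj
    apply Finset.sum_eq_zero
    intro m _
    have h1 : (w m).natDegree ≤ Finset.univ.sup fun m => (w m).natDegree :=
      Finset.le_sup (f := fun m => (w m).natDegree) (Finset.mem_univ m)
    rw [if_pos (by omega), Polynomial.coeff_eq_zero_of_natDegree_lt (by omega), zero_smul]
  · obtain ⟨m, hm⟩ := Function.ne_iff.mp hw0
    refine ⟨((w m).natDegree : ℤ), fun h => hm ?_⟩
    have := Fintype.linearIndependent_iff.mp b.linearIndependent _ h m
    simpa using this
  · intro j
    apply b'.repr.injective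
    ext p
    have hp : ∀ k : ℕ, b'.repr (T k (∑ m, (if 0 ≤ j - k then (w m).coeff (j - k).toNat else 0) • b m)) p
        = ∑ m, LinearMap.toMatrix b b' (T k) p m *
            (if 0 ≤ j - k then (w m).coeff (j - k).toNat else 0) := by
      intro k
      simp only [map_sum, map_smul, Finsupp.coe_finsetSum, Finset.sum_apply, Finsupp.smul_apply,
        smul_eq_mul, LinearMap.toMatrix_apply]
      exact Finset.sum_congr rfl fun _ _ => mul_comm _ _
    have hwp := congrFun hw p
    simp only [Matrix.mulVec, dotProduct, B, Pi.zero_apply] at hwp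
    simp only [map_sum, map_zero, Finsupp.coe_finsetSum, Finset.sum_apply, Finsupp.coe_zero,
      Pi.zero_apply] at hp ⊢
    rw [Finset.sum_congr rfl fun k _ => hp k]
    by_cases hj : 0 ≤ j
    · have hc := congrArg (fun q => Polynomial.coeff q j.toNat) hwp
      simp only [Polynomial.finsetSum_coeff, Finset.sum_mul, Polynomial.coeff_zero] at hc
      rw [Finset.sum_comm] at hc
      refine Eq.trans ?_ hc
      refine Finset.sum_congr rfl fun k _ => Finset.sum_congr rfl fun m _ => ?_
      rw [mul_assoc, Polynomial.coeff_C_mul, Polynomial.coeff_X_pow_mul']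
      congr 1
      by_cases hk : k ≤ j.toNat
      · rw [if_pos (by omega), if_pos hk]
        congr 1
        omega
      · rw [if_neg (by omega), if_neg hk]
    · refine Finset.sum_eq_zero fun k _ => Finset.sum_eq_zero fun m _ => ?_
      rw [if_neg (by omega), mul_zero]

/-- The Clebsch-Gordan nonvanishing statement: in characteristic zero, multiplication by
`(x + t) ^ n` is injective on the degree `i` part of `K[x, t] / (x ^ m, t ^ f)`
when `2 * i + n = m + f - 2`. -/
theorem truncated_binomial_injective {K : Type} [Field K] [CharZero K] (m f n i : ℕ)
    (hsum : 2 * i + n + 2 = m + f) (p : ℕ → K)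
    (hp : ∀ l, p l ≠ 0 → l ≤ i ∧ l < f ∧ i < m + l)
    (hrel : ∀ j, j < f → j ≤ i + n → i + n < m + j →
      ∑ k ∈ Finset.range (j + 1), (n.choose k : K) * p (j - k) = 0) :
    ∀ l, p l = 0 := by
  classical
  let P : Polynomial K := ∑ l ∈ Finset.range (i + 1), Polynomial.monomial l (p l)
  have hPc : ∀ l, P.coeff l = p l := by
    intro l
    simp only [P, Polynomial.finsetSum_coeff, Polynomial.coeff_monomial]
    rw [Finset.sum_ite_eq' (Finset.range (i + 1)) l]
    by_cases hl : l ∈ Finset.range (i + 1)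
    · rw [if_pos hl]
    · rw [if_neg hl]
      by_contra h
      have := (hp l (fun h' => h h'.symm)).1
      simp at hl
      omega
  suffices hP : P = 0 by
    intro l
    rw [← hPc, hP, Polynomial.coeff_zero]
  by_contra hP0
  have hPle : P.natDegree ≤ i ∧ P.natDegree < f ∧ i < m + P.natDegree := by
    apply hp
    rw [← hPc]
    simpa using hP0
  let L : Polynomial K := (1 + Polynomial.X) ^ n
  have hLmon : L.Monic := by
    have : (1 + Polynomial.X : Polynomial K).Monic := by
      rw [add_comm]; exact Polynomial.monic_X_add_C (1 : K)
    exact this.pow n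
  have hLdeg : L.natDegree = n := by
    have h1 : (1 + Polynomial.X : Polynomial K).natDegree = 1 := by
      rw [add_comm]; exact Polynomial.natDegree_X_add_C (1 : K)
    simp [L, Polynomial.natDegree_pow, h1]
  let Q : Polynomial K := L * P
  have hQ0 : Q ≠ 0 := mul_ne_zero hLmon.ne_zero hP0
  have hQdeg : Q.natDegree = n + P.natDegree := by
    rw [Polynomial.natDegree_mul hLmon.ne_zero hP0, hLdeg]
  have hQc : ∀ j, j < f → i + n < m + j → Q.coeff j = 0 := by
    intro j hj hj'
    by_cases hjn : j ≤ i + n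
    · rw [← hrel j hj hjn hj', Polynomial.coeff_mul,
        Finset.Nat.sum_antidiagonal_eq_sum_range_succ_mk]
      refine Finset.sum_congr rfl fun k _ => ?_
      rw [hPc, Polynomial.coeff_one_add_X_pow]
    · exact Polynomial.coeff_eq_zero_of_natDegree_lt (by omega)
  -- differentiate away the low-degree part
  let e := f - 1 - i
  let R : Polynomial K := Polynomial.derivative^[e] Q
  have hRc : ∀ j, R.coeff j = ((j + e).descFactorial e) • Q.coeff (j + e) := by
    intro j
    exact Polynomial.coeff_iterate_derivative (p := Q) j
  have hRX : (Polynomial.X : Polynomial K) ^ (f - e) ∣ R := by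
    refine Polynomial.X_pow_dvd_iff.mpr ?_
    intro j hj
    rw [hRc, hQc (j + e) (by omega) (by omega), smul_zero]
  have hRL : (1 + Polynomial.X : Polynomial K) ^ (n - e) ∣ R :=
    Polynomial.pow_sub_dvd_iterate_derivative_of_pow_dvd e (dvd_mul_right L P)
  have hcop : IsCoprime ((Polynomial.X : Polynomial K) ^ (f - e)) ((1 + Polynomial.X) ^ (n - e)) := by
    refine IsCoprime.pow (R := Polynomial K) ?_
    exact ⟨(-1 : Polynomial K), (1 : Polynomial K), by ring⟩
  have hRdvd := hcop.mul_dvd hRX hRL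
  have hRdeg : R.natDegree ≤ n + P.natDegree - e := by
    rw [← hQdeg]; exact Polynomial.natDegree_iterate_derivative Q e
  have hR0 : R = 0 := by
    by_contra hR0
    have h1 := Polynomial.natDegree_le_of_dvd hRdvd hR0
    have h2 : (1 + Polynomial.X : Polynomial K).Monic := by
      rw [add_comm]; exact Polynomial.monic_X_add_C (1 : K)
    have h3 : (1 + Polynomial.X : Polynomial K).natDegree = 1 := by
      rw [add_comm]; exact Polynomial.natDegree_X_add_C (1 : K)
    rw [Polynomial.natDegree_mul (pow_ne_zero _ Polynomial.X_ne_zero) (h2.pow _).ne_zero,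
      Polynomial.natDegree_X_pow, Polynomial.natDegree_pow, h3] at h1
    omega
  have hQtop : n + P.natDegree < e := by
    by_contra hlt
    have h1 := hRc (n + P.natDegree - e)
    rw [hR0, Polynomial.coeff_zero, Nat.sub_add_cancel (by omega), ← hQdeg] at h1
    have h2 : Q.coeff Q.natDegree ≠ 0 := by simpa using hQ0
    rw [nsmul_eq_mul] at h1
    rcases mul_eq_zero.mp h1.symm with h3 | h3
    · rw [Nat.cast_eq_zero, Nat.descFactorial_eq_zero_iff_lt] at h3
      omega
    · exact h2 h3
  omega

/-- If the powers `(g + t • h) ^ n : X → Y` of a commuting pencil fail to be injective for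
infinitely many `t`, then there is a nonzero polynomial kernel vector. -/
theorem exists_pencil_kernel {K V : Type} [Field K] [AddCommGroup V] [Module K V]
    [FiniteDimensional K V] {g h : Module.End K V} (hgh : Commute g h) {X Y : Submodule K V}
    (hXY : Module.finrank K X = Module.finrank K Y) {n : ℕ}
    (hmap : ∀ k ≤ n, ∀ x ∈ X, (g ^ (n - k)) ((h ^ k) x) ∈ Y)
    (hinf : {t : K | ∃ x ∈ X, x ≠ 0 ∧ ((g + t • h) ^ n) x = 0}.Infinite) :
    ∃ (v : ℤ → V) (M : ℤ), (∀ j, v j ∈ X) ∧ (∀ j < 0, v j = 0) ∧ (∀ j, M ≤ j → v j = 0) ∧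
      (∃ j, v j ≠ 0) ∧
      ∀ j : ℤ, ∑ k ∈ Finset.range (n + 1),
        (n.choose k : K) • (g ^ (n - k)) ((h ^ k) (v (j - k))) = 0 := by
  classical
  let T : ℕ → X →ₗ[K] Y := fun k =>
    if hk : k ≤ n then
      (n.choose k : K) • ((g ^ (n - k) * h ^ k).restrict (p := X) (q := Y) (hmap k hk))
    else 0
  have hT : ∀ k ∈ Finset.range (n + 1), ∀ x : X,
      ((T k x : Y) : V) = (n.choose k : K) • (g ^ (n - k)) ((h ^ k) x) := by
    intro k hk x
    have hk' : k ≤ n := by simpa [Nat.lt_succ_iff] using hk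
    simp [T, hk', LinearMap.restrict_apply]
  have hexp : ∀ (t : K) (x : V), ((g + t • h) ^ n) x =
      ∑ k ∈ Finset.range (n + 1), t ^ k • (n.choose k : K) • (g ^ (n - k)) ((h ^ k) x) := by
    intro t x
    rw [add_comm, (hgh.symm.smul_left t).add_pow, LinearMap.sum_apply]
    refine Finset.sum_congr rfl fun k _ => ?_
    have hc : (h ^ k) ((g ^ (n - k)) x) = (g ^ (n - k)) ((h ^ k) x) :=
      LinearMap.congr_fun (hgh.symm.pow_pow k (n - k)).eq x
    rw [smul_pow, Module.End.mul_apply, Module.End.mul_apply, LinearMap.smul_apply,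
      Module.End.natCast_apply, map_nsmul, map_nsmul, hc, Nat.cast_smul_eq_nsmul]
  obtain ⟨v, M, h1, h2, ⟨j0, h3⟩, h4⟩ := exists_polynomial_kernel hXY T (n + 1) (by
    refine hinf.mono ?_
    rintro t ⟨x, hx, hx0, hker⟩
    refine ⟨⟨x, hx⟩, fun h => hx0 (congrArg Subtype.val h), Subtype.ext ?_⟩
    rw [hexp] at hker
    change Y.subtype _ = 0
    rw [map_sum, ← hker]
    refine Finset.sum_congr rfl fun k hk => ?_
    rw [map_smul, Submodule.coe_subtype, hT k hk])
  refine ⟨fun j => v j, M, fun j => (v j).2, fun j hj => by simp [h1 j hj],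
    fun j hj => by simp [h2 j hj], ⟨j0, fun h => h3 (Subtype.ext h)⟩, fun j => ?_⟩
  have := congrArg (Submodule.subtype Y) (h4 j)
  rw [map_sum, map_zero] at this
  rw [← this]
  refine Finset.sum_congr rfl fun k hk => ?_
  rw [Submodule.coe_subtype, hT k hk]

/-- Injectivity of the power of a commuting pencil is an open condition on the parameter. -/
theorem finite_pencil_not_injective {K V : Type} [Field K] [AddCommGroup V] [Module K V]
    [FiniteDimensional K V] {g h : Module.End K V} (hgh : Commute g h) {X Y : Submodule K V}
    (hXY : Module.finrank K X = Module.finrank K Y) {n : ℕ}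
    (hmap : ∀ k ≤ n, ∀ x ∈ X, (g ^ (n - k)) ((h ^ k) x) ∈ Y)
    (hinj : ∀ x ∈ X, (g ^ n) x = 0 → x = 0) :
    {t : K | ∃ x ∈ X, x ≠ 0 ∧ ((g + t • h) ^ n) x = 0}.Finite := by
  classical
  by_contra hinf
  obtain ⟨v, M, hvX, hneg, -, ⟨j0, hj0⟩, hrel⟩ := exists_pencil_kernel hgh hXY hmap hinf
  have hall : ∀ m : ℕ, ∀ j : ℤ, j < m → v j = 0 := by
    intro m
    induction m with
    | zero => exact fun j hj => hneg j (by exact_mod_cast hj)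
    | succ m ih =>
      intro j hj
      apply hinj _ (hvX j)
      have h := hrel j
      rw [Finset.sum_eq_single 0] at h
      · simpa using h
      · intro k _ hk
        rw [ih (j - k) (by push_cast at hj; omega)]
        simp
      · simp
  exact hj0 (hall (j0.toNat + 1) j0 (by push_cast; omega))

/-- The tensor product of a space with a strong Lefschetz operator and `K[t] / (t ^ f)` has the
strong Lefschetz property, in the form of injectivity of `(G + t) ^ n` in degree `i`. -/
theorem IsSLEndo.tensor_truncated_injective {K V : Type} [Field K] [CharZero K] [AddCommGroup V]
    [Module K V] {ℳ : ℤ → Submodule K V} {a b : ℤ} {G : Module.End K V}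
    (hG : ∀ k, ∀ v ∈ ℳ k, G v ∈ ℳ (k + 1))
    (hzero : ∀ i : ℤ, i < a ∨ b < i → ℳ i = ⊥) (hSL : IsSLEndo K ℳ a b G)
    {f n : ℕ} {i : ℤ} (hsum : 2 * i + n + 1 = a + b + f) (u : ℕ → V)
    (hu : ∀ j, j < f → u j ∈ ℳ (i - j))
    (hrel : ∀ j, j < f →
      ∑ k ∈ Finset.range (j + 1), (n.choose k : K) • (G ^ (n - k)) (u (j - k)) = 0) :
    ∀ j, j < f → u j = 0 := by
  classical
  have hGpow : ∀ (e : ℕ) (k : ℤ), ∀ v ∈ ℳ k, (G ^ e) v ∈ ℳ (k + e) := by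
    intro e
    induction e with
    | zero => intro k v hv; simpa using hv
    | succ e ih =>
      intro k v hv
      rw [pow_succ', Module.End.mul_apply]
      have := hG _ _ (ih k v hv)
      rwa [show k + ((e + 1 : ℕ) : ℤ) = k + e + 1 by push_cast; ring]
  have hadd : ∀ (e e' : ℕ) (v : V), (G ^ e) ((G ^ e') v) = (G ^ (e + e')) v := by
    intro e e' v
    rw [pow_add, Module.End.mul_apply]
  -- `G ^ e` is injective in low degrees
  have hinj : ∀ (d : ℤ) (e : ℕ), (e : ℤ) ≤ a + b - 2 * d → ∀ v ∈ ℳ d, (G ^ e) v = 0 → v = 0 := by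
    intro d e he v hv h
    by_cases hd : d < a
    · rw [hzero d (Or.inl hd)] at hv
      simpa using hv
    · have h1 := (hSL (d - a).toNat (by omega)).1 v (by
        rwa [show a + ((d - a).toNat : ℤ) = d by omega])
      apply h1
      rw [show (b - a - 2 * ((d - a).toNat : ℤ)).toNat = ((a + b - 2 * d).toNat - e) + e by omega,
        ← hadd, h, map_zero]
  -- high degrees are reached from low degrees
  have hsurj : ∀ (d k : ℤ), 2 * d ≤ a + b → a + b - d ≤ k → ∀ w ∈ ℳ k,
      ∃ v ∈ ℳ d, (G ^ (k - d).toNat) v = w := by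
    intro d k hd hk w hw
    by_cases hkb : b < k
    · rw [hzero k (Or.inr hkb), Submodule.mem_bot] at hw
      exact ⟨0, zero_mem _, by rw [map_zero, hw]⟩
    · obtain ⟨v, hv, hvw⟩ := (hSL (b - k).toNat (by omega)).2 w (by
        rwa [show b - ((b - k).toNat : ℤ) = k by omega])
      refine ⟨(G ^ (d - (a + b - k)).toNat) v, ?_, ?_⟩
      · have := hGpow (d - (a + b - k)).toNat _ v hv
        rwa [show a + ((b - k).toNat : ℤ) + ((d - (a + b - k)).toNat : ℤ) = d by omega] at this
      · rw [hadd, ← hvw]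
        congr 2
        omega
  -- descend along the filtration by submodules generated in degrees at most `d`
  let d0 := (a + b) / 2
  suffices hfil : ∀ r : ℕ, ∀ j, j < f → d0 - r < i - j →
      ∃ v ∈ ℳ (d0 - r), u j = (G ^ (i - j - (d0 - r)).toNat) v by
    intro j hj
    by_cases hja : i - j < a
    · have := hu j hj
      rw [hzero _ (Or.inl hja)] at this
      simpa using this
    · obtain ⟨v, hv, huv⟩ := hfil (d0 - a + 1).toNat j hj (by omega)
      rw [hzero _ (Or.inl (by omega))] at hv
      rw [huv, (Submodule.mem_bot K).mp hv, map_zero]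
  intro r
  induction r with
  | zero =>
    intro j hj hd
    obtain ⟨v, hv, h⟩ := hsurj d0 (i - j) (by omega) (by omega) (u j) (hu j hj)
    exact ⟨v, by simpa using hv, by simpa using h.symm⟩
  | succ r ih =>
    set d : ℤ := d0 - r with hd
    have hd1 : d0 - ((r + 1 : ℕ) : ℤ) = d - 1 := by push_cast; omega
    rw [hd1]
    have h2d : 2 * d ≤ a + b := by omega
    let Y : Submodule K V := (ℳ (d - 1)).map G
    -- leading coefficients
    have hex : ∀ j : ℕ, ∃ p : V, p ∈ ℳ d ∧
        (p ≠ 0 → j < f ∧ d ≤ i - j ∧ i - j - d ≤ a + b - 2 * d) ∧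
        (j < f → d ≤ i - j → i - j - d ≤ a + b - 2 * d →
          u j = (G ^ (i - j - d).toNat) p) := by
      intro j
      by_cases hj : j < f ∧ d ≤ i - j ∧ i - j - d ≤ a + b - 2 * d
      · obtain ⟨hj1, hj2, hj3⟩ := hj
        rcases hj2.lt_or_eq with h | h
        · obtain ⟨v, hv, huv⟩ := ih j hj1 h
          exact ⟨v, hv, fun _ => ⟨hj1, hj2, hj3⟩, fun _ _ _ => huv⟩
        · refine ⟨u j, by rw [h]; exact hu j hj1, fun _ => ⟨hj1, hj2, hj3⟩, fun _ _ _ => ?_⟩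
          rw [show (i - j - d).toNat = 0 by omega]
          simp
      · exact ⟨0, zero_mem _, fun h => absurd rfl h, fun h1 h2 h3 => absurd ⟨h1, h2, h3⟩ hj⟩
    choose p hpm hps hpu using hex
    -- terms outside the string range already come from degree `d - 1`
    have hout : ∀ j, j < f → d ≤ i - j → a + b - 2 * d < i - j - d →
        ∃ v ∈ ℳ (d - 1), u j = (G ^ (i - j - (d - 1)).toNat) v := by
      intro j hj h1 h2
      obtain ⟨v, hv, h⟩ := hsurj (d - 1) (i - j) (by omega) (by omega) (u j) (hu j hj)
      exact ⟨v, hv, h.symm⟩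
    have hpY : ∀ j, p j ∈ Y := by
      by_cases hid : i < d
      · intro j
        by_contra h
        have := hps j (fun h0 => h (h0 ▸ zero_mem _))
        omega
      · have hYrel : ∀ j, j < f → (j : ℤ) ≤ i - d + n →
            i - d + n - j ≤ a + b - 2 * d →
            ∑ k ∈ Finset.range (j + 1), (n.choose k : K) • p (j - k) ∈ Y := by
          intro j hj hj1 hj2
          let e := (i - d + n - j).toNat
          have hterm : ∀ k ∈ Finset.range (j + 1), ∃ q ∈ ℳ (d - 1),
              (n.choose k : K) • (G ^ (n - k)) (u (j - k)) =
                (G ^ e) ((n.choose k : K) • p (j - k)) + (G ^ (e + 1)) q := by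
            intro k hk
            have hkj : k ≤ j := by simpa [Nat.lt_succ_iff] using hk
            by_cases hkn : n < k
            · refine ⟨0, zero_mem _, ?_⟩
              simp [Nat.choose_eq_zero_of_lt hkn]
            have hcast : ((j - k : ℕ) : ℤ) = j - k := by push_cast [hkj]; ring
            have hzero' : ¬ (d ≤ i - (j - k : ℕ) ∧ i - (j - k : ℕ) - d ≤ a + b - 2 * d) →
                p (j - k) = 0 := by
              intro h
              by_contra h0
              exact h (hps _ h0).2
            by_cases hlow : i - (j - k : ℕ) < d
            · refine ⟨(n.choose k : K) • (G ^ (d - 1 - (i - (j - k : ℕ))).toNat) (u (j - k)), ?_, ?_⟩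
              · apply Submodule.smul_mem
                have := hGpow (d - 1 - (i - (j - k : ℕ))).toNat _ _ (hu (j - k) (by omega))
                rwa [show i - ((j - k : ℕ) : ℤ) + ((d - 1 - (i - (j - k : ℕ))).toNat : ℤ) = d - 1
                  by omega] at this
              · rw [hzero' (by omega), smul_zero, map_zero, zero_add, map_smul, hadd]
                congr 3
                omega
            · by_cases hhigh : i - (j - k : ℕ) - d ≤ a + b - 2 * d
              · refine ⟨0, zero_mem _, ?_⟩
                rw [hpu (j - k) (by omega) (by omega) hhigh, map_zero, add_zero, hadd, map_smul]
                congr 3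
                omega
              · obtain ⟨v, hv, huv⟩ := hout (j - k) (by omega) (by omega) (by omega)
                refine ⟨(n.choose k : K) • v, Submodule.smul_mem _ _ hv, ?_⟩
                rw [hzero' (by omega), huv, hadd, smul_zero, map_zero, zero_add, map_smul]
                congr 3
                omega
          choose! q hq hqe using hterm
          have h0 := hrel j hj
          rw [Finset.sum_congr rfl hqe, Finset.sum_add_distrib, ← map_sum, ← map_sum] at h0
          have hQ : ∑ k ∈ Finset.range (j + 1), q k ∈ ℳ (d - 1) := Submodule.sum_mem _ hq
          rw [← hadd e 1, pow_one, ← map_add] at h0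
          have hGQ := hG _ _ hQ
          rw [sub_add_cancel] at hGQ
          have hsum0 := hinj d e (by omega) _ (Submodule.add_mem _
            (Submodule.sum_mem _ fun k _ => Submodule.smul_mem _ _ (hpm (j - k))) hGQ) h0
          rw [eq_neg_of_add_eq_zero_left hsum0]
          exact Submodule.neg_mem _ (Submodule.mem_map_of_mem hQ)
        intro j
        rw [← Submodule.Quotient.mk_eq_zero, ← Module.forall_dual_apply_eq_zero_iff K]
        intro φ
        refine truncated_binomial_injective (a + b - 2 * d + 1).toNat f n (i - d).toNat
          (by omega) (fun j => φ (Submodule.Quotient.mk (p j))) ?_ ?_ j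
        · intro l hl
          have := hps l (fun h0 => hl (by simp [h0]))
          omega
        · intro j hj hj1 hj2
          have h1 := hYrel j hj (by omega) (by omega)
          rw [← Submodule.Quotient.mk_eq_zero, ← Submodule.mkQ_apply, map_sum] at h1
          have h2 := congrArg φ h1
          simpa using h2
    intro j hj hji
    by_cases hhigh : i - j - d ≤ a + b - 2 * d
    · obtain ⟨v, hv, hvp⟩ := hpY j
      refine ⟨v, hv, ?_⟩
      rw [hpu j hj (by omega) hhigh, ← hvp]
      have := hadd (i - j - d).toNat 1 v
      rw [pow_one] at this
      rw [this]
      congr 2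
      omega
    · exact hout j hj (by omega) (by omega)

/-- The homogeneous components of a graded algebra, as linear endomorphisms. -/
theorem IsGradedArtinAlg.exists_proj {K A : Type} [Field K] [CommRing A] [Algebra K A]
    {𝒜 : ℕ → Submodule K A} (hA : IsGradedArtinAlg K 𝒜) :
    ∃ π : ℕ → A →ₗ[K] A, (∀ d x, π d x ∈ 𝒜 d) ∧ (∀ d, ∀ x ∈ 𝒜 d, π d x = x) ∧
      (∀ d e, e ≠ d → ∀ x ∈ 𝒜 e, π d x = 0) ∧
      (∀ (S : Submodule K A) (x : A), (∀ d, π d x ∈ S) → x ∈ S) ∧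
      (∀ e, ∀ a ∈ 𝒜 e, ∀ x d, π (e + d) (a * x) = a * π d x) ∧
      (∀ e d, d < e → ∀ a ∈ 𝒜 e, ∀ x, π d (a * x) = 0) := by
  classical
  obtain ⟨hinter, hone, hmul, -, -⟩ := hA
  let _ : SetLike.GradedMonoid 𝒜 := { one_mem := hone, mul_mem := fun _ _ _ _ ha hb => hmul _ _ _ ha _ hb }
  let _ : DirectSum.Decomposition 𝒜 := hinter.chooseDecomposition
  let _ : GradedRing 𝒜 := {}
  refine ⟨fun d => (𝒜 d).subtype ∘ₗ DirectSum.component K ℕ (fun i => 𝒜 i) d ∘ₗ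
    (DirectSum.decomposeLinearEquiv 𝒜).toLinearMap, ?_, ?_, ?_, ?_, ?_, ?_⟩
  · intro d x
    exact Subtype.property _
  · intro d x hx
    exact DirectSum.decompose_of_mem_same 𝒜 hx
  · intro d e hed x hx
    exact DirectSum.decompose_of_mem_ne 𝒜 hx hed
  · intro S x hx
    rw [← DirectSum.sum_support_decompose 𝒜 x]
    exact Submodule.sum_mem _ fun d _ => hx d
  · intro e a ha x d
    exact DirectSum.coe_decompose_mul_add_of_left_mem 𝒜 ha
  · intro e d hde a ha x
    exact DirectSum.coe_decompose_mul_of_left_mem_of_not_le 𝒜 ha (not_le.mpr hde)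

theorem IsGradedArtinAlg.pow_mem {K A : Type} [Field K] [CommRing A] [Algebra K A]
    {𝒜 : ℕ → Submodule K A} (hA : IsGradedArtinAlg K 𝒜) {a : A} (ha : a ∈ 𝒜 1) (n : ℕ) :
    a ^ n ∈ 𝒜 n := by
  induction n with
  | zero => simpa using hA.2.1
  | succ n ih => rw [pow_succ]; exact hA.2.2.1 _ _ _ ih _ ha

theorem IsGradedArtinAlg.pow_eq_zero {K A : Type} [Field K] [CommRing A] [Algebra K A]
    {𝒜 : ℕ → Submodule K A} (hA : IsGradedArtinAlg K 𝒜) {c : ℕ} (htop : GradedTop K 𝒜 c)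
    {a : A} (ha : a ∈ 𝒜 1) {n : ℕ} (hn : c < n) : a ^ n = 0 := by
  have := hA.pow_mem ha n
  rwa [htop.2 n hn, Submodule.mem_bot] at this

theorem mulMap_apply {K A V : Type} [Field K] [CommRing A] [Algebra K A] [AddCommGroup V]
    [Module K V] [Module A V] [IsScalarTower K A V] (g : A) (v : V) :
    mulMap K V g v = g • v := rfl

theorem mulMap_pow_apply {K A V : Type} [Field K] [CommRing A] [Algebra K A] [AddCommGroup V]
    [Module K V] [Module A V] [IsScalarTower K A V] (g : A) (n : ℕ) (v : V) :
    (mulMap K V g ^ n) v = g ^ n • v := by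
  induction n generalizing v with
  | zero => simp
  | succ n ih => rw [pow_succ, Module.End.mul_apply, ih, mulMap_apply, smul_smul, ← pow_succ]

theorem mulMap_add_smul {K A V : Type} [Field K] [CommRing A] [Algebra K A] [AddCommGroup V]
    [Module K V] [Module A V] [IsScalarTower K A V] (g h : A) (t : K) :
    mulMap K V (g + t • h) = mulMap K V g + t • mulMap K V h := by
  ext v
  simp [mulMap_apply, add_smul]

theorem commute_mulMap {K A V : Type} [Field K] [CommRing A] [Algebra K A] [AddCommGroup V]
    [Module K V] [Module A V] [IsScalarTower K A V] (g h : A) :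
    Commute (mulMap K V g) (mulMap K V h) := by
  ext v
  simp [mulMap_apply, smul_smul, mul_comm]

theorem mem_colonPlus {K A : Type} [Field K] [CommRing A] [Algebra K A] {z : A} {m : ℕ} {x : A} :
    x ∈ colonPlus K z m ↔ ∃ x' y, z ^ m * x' = 0 ∧ x = x' + z * y := by
  rw [colonPlus, Submodule.mem_sup]
  constructor
  · rintro ⟨x', hx', w, hw, rfl⟩
    obtain ⟨y, rfl⟩ := Ideal.mem_span_singleton'.mp hw
    exact ⟨x', y, by simpa using hx', by ring⟩
  · rintro ⟨x', y, h, rfl⟩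
    exact ⟨x', by simpa using h, z * y, Ideal.mem_span_singleton'.mpr ⟨y, mul_comm _ _⟩, rfl⟩

theorem mul_mem_colonPlus {K A : Type} [Field K] [CommRing A] [Algebra K A] (z : A) (m : ℕ)
    (y : A) : z * y ∈ colonPlus K z m :=
  mem_colonPlus.mpr ⟨0, y, by simp, by simp⟩

theorem colonPlus_mono {K A : Type} [Field K] [CommRing A] [Algebra K A] (z : A) :
    Monotone (colonPlus K z) := by
  intro m m' h x hx
  obtain ⟨x', y, h0, rfl⟩ := mem_colonPlus.mp hx
  refine mem_colonPlus.mpr ⟨x', y, ?_, rfl⟩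
  rw [← Nat.sub_add_cancel h, pow_add, mul_assoc, h0, mul_zero]

/-- Homogeneous elements of `(0 : z ^ m) + z A` have homogeneous witnesses. -/
theorem IsGradedArtinAlg.exists_mem_of_mem_colonPlus {K A : Type} [Field K] [CommRing A]
    [Algebra K A] {𝒜 : ℕ → Submodule K A} (hA : IsGradedArtinAlg K 𝒜) {z : A} (hz : z ∈ 𝒜 1)
    {m d : ℕ} {x : A} (hx : x ∈ 𝒜 d) (hxm : x ∈ colonPlus K z m) :
    ∃ x' ∈ 𝒜 d, ∃ y, z ^ m * x' = 0 ∧ x = x' + z * y := by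
  obtain ⟨π, hmem, hsame, -, -, hmul, hlt⟩ := hA.exists_proj
  obtain ⟨x', y, h0, hxy⟩ := mem_colonPlus.mp hxm
  have hzy : ∃ y', π d (z * y) = z * y' := by
    rcases d with _ | d
    · exact ⟨0, by rw [hlt 1 0 one_pos z hz, mul_zero]⟩
    · exact ⟨π d y, by rw [add_comm d 1, hmul 1 z hz]⟩
  obtain ⟨y', hy'⟩ := hzy
  refine ⟨π d x', hmem _ _, y', ?_, ?_⟩
  · rw [← hmul m _ (hA.pow_mem hz m), h0, map_zero]
  · rw [← hy', ← map_add, ← hxy, hsame d x hx]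

/-- `(0 : z ^ m) + z A` is a homogeneous ideal. -/
theorem IsGradedArtinAlg.exists_mem_notMem_of_not_le {K A : Type} [Field K] [CommRing A]
    [Algebra K A] {𝒜 : ℕ → Submodule K A} (hA : IsGradedArtinAlg K 𝒜) {z : A} (hz : z ∈ 𝒜 1)
    {m m' : ℕ} (h : ¬ colonPlus K z m ≤ colonPlus K z m') :
    ∃ d, ∃ x ∈ 𝒜 d, x ∈ colonPlus K z m ∧ x ∉ colonPlus K z m' := by
  obtain ⟨π, hmem, hsame, -, hS, hmul, hlt⟩ := hA.exists_proj
  by_contra! hcon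
  apply h
  intro x hx
  refine hS ((colonPlus K z m').restrictScalars K) x fun d => ?_
  refine hcon d _ (hmem d x) ?_
  obtain ⟨x', y, h0, rfl⟩ := mem_colonPlus.mp hx
  rw [map_add]
  refine Ideal.add_mem _ (mem_colonPlus.mpr ⟨π d x', 0, ?_, by simp⟩) ?_
  · rw [← hmul m _ (hA.pow_mem hz m), h0, map_zero]
  · rcases d with _ | d
    · rw [hlt 1 0 one_pos z hz]
      exact zero_mem _
    · rw [add_comm d 1, hmul 1 z hz]
      exact mul_mem_colonPlus z m _

/-- A graded Artinian Gorenstein algebra has a nondegenerate form concentrated in top degree. -/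
theorem IsGorenstein.exists_form {K A : Type} [Field K] [CommRing A] [Algebra K A]
    {𝒜 : ℕ → Submodule K A} {c : ℕ} (hA : IsGradedArtinAlg K 𝒜) (htop : GradedTop K 𝒜 c)
    (hGor : IsGorenstein K 𝒜) :
    ∃ φ : A →ₗ[K] K, (∀ e, e ≠ c → ∀ x ∈ 𝒜 e, φ x = 0) ∧
      ∀ x, (∀ y, φ (x * y) = 0) → x = 0 := by
  classical
  obtain ⟨π, hmem, hsame, hne, hS, hmul, hlt⟩ := hA.exists_proj
  obtain ⟨s, hs0, -, hsoc⟩ := hGor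
  have hcs : ∀ x ∈ 𝒜 c, ∃ r : K, x = r • s := by
    intro x hx
    apply hsoc
    intro i hi y hy
    have := hA.2.2.1 _ _ _ hx _ hy
    rwa [htop.2 _ (by omega), Submodule.mem_bot] at this
  have hex : ∀ d, ∀ x ∈ 𝒜 d, x ≠ 0 → ∃ e, d + e = c ∧ ∃ y ∈ 𝒜 e, x * y ≠ 0 := by
    intro d x hx hx0
    let Pr : ℕ → Prop := fun e => ∃ y ∈ 𝒜 e, x * y ≠ 0
    have hP0 : Pr 0 := ⟨1, hA.2.1, by simpa using hx0⟩
    have hbound : ∀ e, Pr e → e ≤ c := by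
      rintro e ⟨y, hy, hxy⟩
      by_contra hlt
      have := hA.2.2.1 _ _ _ hx _ hy
      rw [htop.2 _ (by omega), Submodule.mem_bot] at this
      exact hxy this
    obtain ⟨y, hy, hxy⟩ : Pr (Nat.findGreatest Pr c) := Nat.findGreatest_spec (Nat.zero_le c) hP0
    refine ⟨Nat.findGreatest Pr c, ?_, y, hy, hxy⟩
    obtain ⟨r, hr⟩ := hsoc (x * y) (by
      intro i hi y' hy'
      by_contra h
      rw [mul_assoc] at h
      have h1 : Pr (Nat.findGreatest Pr c + i) := ⟨y * y', hA.2.2.1 _ _ _ hy _ hy', h⟩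
      have := Nat.le_findGreatest (hbound _ h1) h1
      omega)
    obtain ⟨t, ht, ht0⟩ := Submodule.exists_mem_ne_zero_of_ne_bot htop.1
    obtain ⟨r', hr'⟩ := hcs t ht
    have hr'0 : r' ≠ 0 := by
      rintro rfl
      exact ht0 (by rw [hr', zero_smul])
    have hxyc : x * y ∈ 𝒜 c := by
      rw [hr, show s = r'⁻¹ • t by rw [hr', smul_smul, inv_mul_cancel₀ hr'0, one_smul]]
      exact Submodule.smul_mem _ _ (Submodule.smul_mem _ _ ht)
    by_contra hcon
    apply hxy
    rw [← hsame c _ hxyc]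
    exact hne c _ hcon _ (hA.2.2.1 _ _ _ hx _ hy)
  obtain ⟨ψ, hψ⟩ : ∃ ψ : Module.Dual K A, ψ s ≠ 0 := by
    by_contra! h
    exact hs0 ((Module.forall_dual_apply_eq_zero_iff K s).mp h)
  have hinj : ∀ x ∈ 𝒜 c, ψ x = 0 → x = 0 := by
    intro x hx h
    obtain ⟨r, rfl⟩ := hcs x hx
    rw [map_smul, smul_eq_mul, mul_eq_zero] at h
    rw [h.resolve_right hψ, zero_smul]
  refine ⟨ψ ∘ₗ π c, ?_, ?_⟩
  · intro e he x hx
    rw [LinearMap.comp_apply, hne c e he x hx, map_zero]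
  · intro x hx
    refine (Submodule.mem_bot K).mp (hS ⊥ x fun d => ?_)
    rw [Submodule.mem_bot]
    by_contra h0
    obtain ⟨e, hde, y, hy, hxy⟩ := hex d _ (hmem d x) h0
    apply hxy
    have h1 : π c (x * y) = π d x * y := by
      rw [← hde, mul_comm x y, add_comm d e, hmul e y hy, mul_comm]
    rw [← h1]
    exact hinj _ (hmem _ _) (hx y)

/-- The annihilator of `(0 : w)` is the principal ideal generated by `w`. -/
theorem exists_eq_mul_of_annihilates {K A : Type} [Field K] [CommRing A] [Algebra K A]
    [FiniteDimensional K A] {φ : A →ₗ[K] K} (hφ : ∀ x, (∀ y, φ (x * y) = 0) → x = 0) {w x : A}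
    (hx : ∀ y, w * y = 0 → φ (x * y) = 0) : ∃ a, x = w * a := by
  by_contra! hcon
  let S : Submodule K A := LinearMap.range (LinearMap.mulLeft K w)
  have hxS : x ∉ S := by
    rintro ⟨a, ha⟩
    exact hcon a ha.symm
  obtain ⟨ψ, hψx, hψS⟩ := Submodule.exists_le_ker_of_notMem hxS
  let B : A →ₗ[K] Module.Dual K A := (LinearMap.mul K A).compr₂ φ
  have hB : Function.Injective B := by
    rw [← LinearMap.ker_eq_bot, LinearMap.ker_eq_bot']
    intro y hy
    exact hφ y fun y' => LinearMap.congr_fun hy y'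
  obtain ⟨y, hy⟩ := (LinearMap.injective_iff_surjective_of_finrank_eq_finrank
    (Subspace.dual_finrank_eq (K := K) (V := A)).symm).mp hB ψ
  have hyv : ∀ a, ψ a = φ (y * a) := fun a => by rw [← hy]; rfl
  apply hψx
  rw [hyv, mul_comm]
  apply hx
  apply hφ
  intro a
  have : ψ (w * a) = 0 := hψS ⟨a, rfl⟩
  rw [← this, hyv]
  congr 1
  ring

theorem IsGorenstein.finrank_eq {K A : Type} [Field K] [CommRing A] [Algebra K A]
    {𝒜 : ℕ → Submodule K A} {c : ℕ} (hA : IsGradedArtinAlg K 𝒜) (htop : GradedTop K 𝒜 c)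
    (hGor : IsGorenstein K 𝒜) {i j : ℕ} (hij : i + j = c) :
    Module.finrank K (𝒜 i) = Module.finrank K (𝒜 j) := by
  have : FiniteDimensional K A := hA.2.2.2.2
  obtain ⟨φ, hφc, hφ⟩ := hGor.exists_form hA htop
  obtain ⟨π, hmem, hsame, hne, hS, hmul, hlt⟩ := hA.exists_proj
  have key : ∀ i j, i + j = c → Module.finrank K (𝒜 i) ≤ Module.finrank K (𝒜 j) := by
    intro i j hij
    let B : 𝒜 i →ₗ[K] Module.Dual K (𝒜 j) :=
      ((LinearMap.mul K A).compr₂ φ).compl₁₂ (𝒜 i).subtype (𝒜 j).subtype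
    have hB : Function.Injective B := by
      rw [← LinearMap.ker_eq_bot, LinearMap.ker_eq_bot']
      intro x hx
      refine Subtype.ext (hφ x fun y => ?_)
      have h1 : (x : A) * y ∈ LinearMap.ker φ := by
        refine hS _ _ fun d => ?_
        rw [LinearMap.mem_ker]
        by_cases hd : d = c
        · rw [hd, ← hij, hmul i x x.2]
          exact LinearMap.congr_fun hx ⟨π j y, hmem j y⟩
        · exact hφc d hd _ (hmem _ _)
      exact h1
    rw [← Subspace.dual_finrank_eq (K := K) (V := 𝒜 j)]
    exact LinearMap.finrank_le_finrank_of_injective hB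
  exact le_antisymm (key i j hij) (key j i (by omega))

/-- The degrees supporting `((0 : z ^ (r + 1)) + z A) / ((0 : z ^ r) + z A)` are symmetric
about `(c - r) / 2`. -/
theorem IsGorenstein.exists_dual_degree {K A : Type} [Field K] [CommRing A] [Algebra K A]
    {𝒜 : ℕ → Submodule K A} {c : ℕ} (hA : IsGradedArtinAlg K 𝒜) (htop : GradedTop K 𝒜 c)
    (hGor : IsGorenstein K 𝒜) {z : A} (hz : z ∈ 𝒜 1) {r d : ℕ} {x : A} (hx : x ∈ 𝒜 d)
    (hxm : x ∈ colonPlus K z (r + 1)) (hxr : x ∉ colonPlus K z r) :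
    ∃ e, d + e + r = c ∧ ∃ y ∈ 𝒜 e, y ∈ colonPlus K z (r + 1) ∧ y ∉ colonPlus K z r := by
  have : FiniteDimensional K A := hA.2.2.2.2
  obtain ⟨φ, hφc, hφ⟩ := hGor.exists_form hA htop
  obtain ⟨π, hmem, hsame, hne, hS, hmul, hlt⟩ := hA.exists_proj
  obtain ⟨x', hx', w, h0, rfl⟩ := hA.exists_mem_of_mem_colonPlus hz hx hxm
  have hx'r : x' ∉ colonPlus K z r := fun h =>
    hxr (Ideal.add_mem _ h (mul_mem_colonPlus z r w))
  obtain ⟨y, hy0, hy⟩ : ∃ y, z ^ (r + 1) * y = 0 ∧ φ (z ^ r * x' * y) ≠ 0 := by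
    by_contra! hcon
    obtain ⟨a, ha⟩ := exists_eq_mul_of_annihilates hφ hcon
    apply hx'r
    refine mem_colonPlus.mpr ⟨x' - z * a, a, ?_, by ring⟩
    rw [mul_sub, ha]
    ring
  have hpm : z ^ r * x' ∈ 𝒜 (r + d) := hA.2.2.1 _ _ _ (hA.pow_mem hz r) _ hx'
  have hπ : π c (z ^ r * x' * y) ≠ 0 := by
    intro hπ
    apply hy
    have h1 : z ^ r * x' * y ∈ LinearMap.ker φ := by
      refine hS _ _ fun e => ?_
      rw [LinearMap.mem_ker]
      by_cases he : e = c
      · rw [he, hπ, map_zero]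
      · exact hφc e he _ (hmem _ _)
    exact h1
  have hle : r + d ≤ c := by
    by_contra hcon
    exact hπ (hlt _ _ (not_le.mp hcon) _ hpm y)
  obtain ⟨e, rfl⟩ := Nat.exists_eq_add_of_le hle
  rw [hmul _ _ hpm] at hπ
  refine ⟨e, by omega, π e y, hmem _ _, mem_colonPlus.mpr ⟨π e y, 0, ?_, by simp⟩, ?_⟩
  · rw [← hmul _ _ (hA.pow_mem hz (r + 1)), hy0, map_zero]
  · intro hyr
    obtain ⟨y', w', h1, h2⟩ := mem_colonPlus.mp hyr
    apply hπ
    rw [h2]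
    calc z ^ r * x' * (y' + z * w') = x' * (z ^ r * y') + (z ^ (r + 1) * x') * w' := by ring
      _ = 0 := by rw [h1, h0]; ring

theorem finrank_colonPlus_add {K A : Type} [Field K] [CommRing A] [Algebra K A]
    [FiniteDimensional K A] (z : A) (n : ℕ) :
    Module.finrank K ((colonPlus K z n).restrictScalars K) +
        Module.finrank K (LinearMap.ker (mulMap K A z ^ (n + 1))) =
      Module.finrank K (LinearMap.ker (mulMap K A z ^ n)) + Module.finrank K A := by
  set F := mulMap K A z with hF
  have hsup : (colonPlus K z n).restrictScalars K = LinearMap.ker (F ^ n) ⊔ LinearMap.range F := by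
    ext x
    rw [Submodule.restrictScalars_mem, mem_colonPlus, Submodule.mem_sup]
    constructor
    · rintro ⟨x', y, h, rfl⟩
      exact ⟨x', by rw [LinearMap.mem_ker, hF, mulMap_pow_apply]; exact h, z * y, ⟨y, rfl⟩, rfl⟩
    · rintro ⟨x', h, _, ⟨y, rfl⟩, rfl⟩
      rw [LinearMap.mem_ker, hF, mulMap_pow_apply] at h
      exact ⟨x', y, h, rfl⟩
  have hinf : LinearMap.ker (F ^ n) ⊓ LinearMap.range F =
      (LinearMap.ker (F ^ (n + 1))).map F := by
    ext x
    simp only [Submodule.mem_inf, LinearMap.mem_ker, LinearMap.mem_range, Submodule.mem_map,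
      pow_succ, Module.End.mul_apply]
    constructor
    · rintro ⟨h, y, rfl⟩
      exact ⟨y, h, rfl⟩
    · rintro ⟨y, h, rfl⟩
      exact ⟨h, y, rfl⟩
  have hle : LinearMap.ker F ≤ LinearMap.ker (F ^ (n + 1)) := by
    intro x hx
    rw [LinearMap.mem_ker, pow_succ, Module.End.mul_apply, LinearMap.mem_ker.mp hx, map_zero]
  have h1 := Submodule.finrank_sup_add_finrank_inf_eq (LinearMap.ker (F ^ n)) (LinearMap.range F)
  have h2 := (F.domRestrict (LinearMap.ker (F ^ (n + 1)))).finrank_range_add_finrank_ker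
  have h3 := F.finrank_range_add_finrank_ker
  rw [LinearMap.range_domRestrict, LinearMap.ker_domRestrict,
    (Submodule.comapSubtypeEquivOfLe hle).finrank_eq] at h2
  rw [hinf, ← hsup] at h1
  omega

theorem Multiset.sum_map_min_succ (d : Multiset ℕ) (n : ℕ) :
    (d.map fun x => min x (n + 1)).sum =
      (d.map fun x => min x n).sum + (d.filter fun x => n < x).card := by
  induction d using Multiset.induction_on with
  | empty => simp
  | cons a d ih =>
    by_cases h : n < a
    · simp [h, ih]
      omega
    · simp [h, ih]
      omega

theorem Multiset.card_filter_lt_eq (d : Multiset ℕ) (n : ℕ) :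
    (d.filter fun x => n < x).card =
      (d.filter fun x => n + 1 < x).card + d.count (n + 1) := by
  induction d using Multiset.induction_on with
  | empty => simp
  | cons a d ih =>
    simp only [Multiset.filter_cons, Multiset.card_add, Multiset.count_cons, ih]
    split_ifs <;> simp <;> omega

/-- The Jordan block sizes of `×z` are the jumps of the filtration `(0 : z ^ n) + z A`. -/
theorem IsJordanType.succ_mem_iff {K A : Type} [Field K] [CommRing A] [Algebra K A]
    [FiniteDimensional K A] {z : A} {d : Multiset ℕ} (hd : IsJordanType K (mulMap K A z) d)
    (n : ℕ) : n + 1 ∈ d ↔ ¬ colonPlus K z (n + 1) ≤ colonPlus K z n := by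
  have hfin : ∀ k, Module.finrank K ((colonPlus K z k).restrictScalars K) +
      (d.filter fun x => k < x).card = Module.finrank K A := by
    intro k
    have h1 := finrank_colonPlus_add (K := K) z k
    rw [hd.2, hd.2, Multiset.sum_map_min_succ] at h1
    omega
  have h1 := hfin n
  have h2 := hfin (n + 1)
  have h3 := Multiset.card_filter_lt_eq d n
  have hmono : (colonPlus K z n).restrictScalars K ≤ (colonPlus K z (n + 1)).restrictScalars K :=
    colonPlus_mono (K := K) z (Nat.le_succ n)
  rw [← Multiset.count_pos]
  constructor
  · intro hpos hle
    have h4 : Module.finrank K ((colonPlus K z (n + 1)).restrictScalars K) ≤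
      Module.finrank K ((colonPlus K z n).restrictScalars K) := Submodule.finrank_mono hle
    omega
  · intro hle
    by_contra hpos
    exact hle (Submodule.eq_of_le_of_finrank_eq hmono (by omega)).ge

/-- Multiplication by a nilpotent element has a Jordan type. -/
theorem exists_isJordanType {K A : Type} [Field K] [CommRing A] [Algebra K A]
    [FiniteDimensional K A] {z : A} (hz : IsNilpotent z) :
    ∃ d : Multiset ℕ, IsJordanType K (mulMap K A z) d := by
  obtain ⟨N, hN⟩ := hz
  let e : ℕ → ℕ := fun n => Module.finrank K ((colonPlus K z n).restrictScalars K)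
  have hmono : Monotone e := fun m m' h =>
    Submodule.finrank_mono (show (colonPlus K z m).restrictScalars K ≤
      (colonPlus K z m').restrictScalars K from colonPlus_mono (K := K) z h)
  have htop : ∀ n, N ≤ n → e n = Module.finrank K A := by
    intro n hn
    have : (colonPlus K z n).restrictScalars K = ⊤ := by
      rw [eq_top_iff]
      intro x _
      refine (mem_colonPlus (K := K)).mpr ⟨x, 0, ?_, by simp⟩
      rw [pow_eq_zero_of_le hn hN, zero_mul]
    simp only [e]
    rw [this, finrank_top]
  let d : Multiset ℕ := ∑ n ∈ Finset.range N, Multiset.replicate (e (n + 1) - e n) (n + 1)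
  have hsum : ∀ k M, (∑ n ∈ Finset.range M, if k ≤ n then e (n + 1) - e n else 0) + e (min k M) =
      e M := by
    intro k M
    induction M with
    | zero => simp
    | succ M ih =>
      rw [Finset.sum_range_succ]
      by_cases hk : k ≤ M
      · rw [if_pos hk, min_eq_left (by omega)]
        rw [min_eq_left hk] at ih
        have := hmono (Nat.le_succ M)
        simp only [Nat.succ_eq_add_one] at this
        omega
      · rw [if_neg hk, min_eq_right (by omega), Finset.sum_eq_zero]
        · simp
        · intro n hn
          rw [if_neg (by simp at hn; omega)]
  have hmap : ∀ k, (d.map fun x => min x k).sum =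
      ∑ n ∈ Finset.range N, (e (n + 1) - e n) * min (n + 1) k := by
    intro k
    simp only [d]
    rw [← Multiset.coe_mapAddMonoidHom, map_sum, ← Multiset.coe_sumAddMonoidHom, map_sum]
    simp
  refine ⟨d, ?_, fun k => ?_⟩
  · intro n hn
    rw [Multiset.mem_sum] at hn
    obtain ⟨m, -, hm⟩ := hn
    rw [Multiset.eq_of_mem_replicate hm]
    omega
  · rw [hmap]
    induction k with
    | zero => simp [Module.End.one_eq_id]
    | succ k ih =>
      have h1 := finrank_colonPlus_add (K := K) z k
      have h2 := hsum k N
      have h3 : ∑ n ∈ Finset.range N, (e (n + 1) - e n) * min (n + 1) (k + 1) =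
          ∑ n ∈ Finset.range N, (e (n + 1) - e n) * min (n + 1) k +
            ∑ n ∈ Finset.range N, if k ≤ n then e (n + 1) - e n else 0 := by
        rw [← Finset.sum_add_distrib]
        refine Finset.sum_congr rfl fun n _ => ?_
        by_cases hk : k ≤ n
        · rw [if_pos hk, min_eq_right (by omega), min_eq_right (by omega)]
          ring
        · rw [if_neg hk, min_eq_left (by omega), min_eq_left (by omega)]
          ring
      have h4 : e (min k N) = e k := by
        by_cases hk : k ≤ N
        · rw [min_eq_left hk]
        · rw [min_eq_right (by omega), htop N le_rfl, htop k (by omega)]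
      rw [htop N le_rfl, h4] at h2
      change e k + _ = _ at h1
      omega

theorem natToZ_natCast {K V : Type} [Field K] [AddCommGroup V] [Module K V]
    (ℒ : ℕ → Submodule K V) (n : ℕ) : natToZ K ℒ n = ℒ n := by
  simp [natToZ]

theorem natToZ_of_neg {K V : Type} [Field K] [AddCommGroup V] [Module K V]
    (ℒ : ℕ → Submodule K V) {i : ℤ} (hi : i < 0) : natToZ K ℒ i = ⊥ := by
  simp [natToZ, not_le.mpr hi]

theorem mem_csGrading {K A : Type} [Field K] [CommRing A] [Algebra K A]
    {𝒜 : ℕ → Submodule K A} {z : A} {m m' d : ℕ} {v : CSMod K z m m'} :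
    v ∈ csGrading K 𝒜 z m m' d ↔
      ∃ x : colonPlus K z m, (x : A) ∈ 𝒜 d ∧ Submodule.Quotient.mk x = v :=
  Iff.rfl

theorem csMod_mk_eq_zero {K A : Type} [Field K] [CommRing A] [Algebra K A] {z : A} {m m' : ℕ}
    {x : colonPlus K z m} :
    (Submodule.Quotient.mk x : CSMod K z m m') = 0 ↔ (x : A) ∈ colonPlus K z m' := by
  rw [Submodule.Quotient.mk_eq_zero]
  rfl

theorem csGrading_ne_bot_iff {K A : Type} [Field K] [CommRing A] [Algebra K A]
    {𝒜 : ℕ → Submodule K A} {z : A} {m m' d : ℕ} :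
    csGrading K 𝒜 z m m' d ≠ ⊥ ↔ ∃ x ∈ 𝒜 d, x ∈ colonPlus K z m ∧ x ∉ colonPlus K z m' := by
  rw [Submodule.ne_bot_iff]
  constructor
  · rintro ⟨v, hv, hv0⟩
    obtain ⟨x, hx, rfl⟩ := mem_csGrading.mp hv
    exact ⟨x, hx, x.2, fun h => hv0 (csMod_mk_eq_zero.mpr h)⟩
  · rintro ⟨x, hx, hxm, hxm'⟩
    exact ⟨Submodule.Quotient.mk ⟨x, hxm⟩, mem_csGrading.mpr ⟨⟨x, hxm⟩, hx, rfl⟩,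
      fun h => hxm' (csMod_mk_eq_zero.mp h)⟩

theorem smul_mem_natToZ_csGrading {K A : Type} [Field K] [CommRing A] [Algebra K A]
    {𝒜 : ℕ → Submodule K A} (hA : IsGradedArtinAlg K 𝒜) {z g : A} (hg : g ∈ 𝒜 1) {m m' : ℕ}
    (k : ℤ) {v : CSMod K z m m'} (hv : v ∈ natToZ K (csGrading K 𝒜 z m m') k) :
    g • v ∈ natToZ K (csGrading K 𝒜 z m m') (k + 1) := by
  by_cases hk : k < 0
  · rw [natToZ_of_neg _ hk, Submodule.mem_bot] at hv
    rw [hv, smul_zero]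
    exact zero_mem _
  · lift k to ℕ using not_lt.mp hk
    rw [natToZ_natCast] at hv
    obtain ⟨x, hx, rfl⟩ := mem_csGrading.mp hv
    rw [show (k : ℤ) + 1 = ((k + 1 : ℕ) : ℤ) by push_cast; rfl, natToZ_natCast]
    refine mem_csGrading.mpr ⟨g • x, ?_, rfl⟩
    rw [add_comm k 1]
    exact hA.2.2.1 _ _ _ hg _ hx

theorem csMod_finiteDimensional {K A : Type} [Field K] [CommRing A] [Algebra K A]
    [FiniteDimensional K A] (z : A) (m m' : ℕ) : FiniteDimensional K (CSMod K z m m') := by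
  have : Module.Finite K (colonPlus K z m) :=
    inferInstanceAs (Module.Finite K ((colonPlus K z m).restrictScalars K))
  exact Module.Finite.quotient K _

theorem exists_apply_eq_of_injective {K V : Type} [Field K] [AddCommGroup V] [Module K V]
    [FiniteDimensional K V] {F : Module.End K V} {X Y : Submodule K V}
    (hXY : Module.finrank K X = Module.finrank K Y) (hmap : ∀ x ∈ X, F x ∈ Y)
    (hinj : ∀ x ∈ X, F x = 0 → x = 0) : ∀ y ∈ Y, ∃ x ∈ X, F x = y := by
  have h : Function.Injective (F.restrict hmap) := by
    rw [← LinearMap.ker_eq_bot, LinearMap.ker_eq_bot']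
    intro x hx
    exact Subtype.ext (hinj x x.2 (congrArg Subtype.val hx))
  intro y hy
  obtain ⟨x, hx⟩ := (LinearMap.injective_iff_surjective_of_finrank_eq_finrank hXY).mp h ⟨y, hy⟩
  exact ⟨x, x.2, congrArg Subtype.val hx⟩

theorem finrank_eq_of_bijective {K V : Type} [Field K] [AddCommGroup V] [Module K V]
    {F : Module.End K V} {X Y : Submodule K V} (hmap : ∀ x ∈ X, F x ∈ Y)
    (hinj : ∀ x ∈ X, F x = 0 → x = 0) (hsurj : ∀ y ∈ Y, ∃ x ∈ X, F x = y) :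
    Module.finrank K X = Module.finrank K Y := by
  refine (LinearEquiv.ofBijective (F.restrict hmap) ⟨?_, ?_⟩).finrank_eq
  · rw [← LinearMap.ker_eq_bot, LinearMap.ker_eq_bot']
    intro x hx
    exact Subtype.ext (hinj x x.2 (congrArg Subtype.val hx))
  · rintro ⟨y, hy⟩
    obtain ⟨x, hx, h⟩ := hsurj y hy
    exact ⟨⟨x, hx⟩, Subtype.ext h⟩

/-- Being a strong Lefschetz element is an open condition along lines. -/
theorem IsSLEndo.finite_not {K A V : Type} [Field K] [CommRing A] [Algebra K A] [AddCommGroup V]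
    [Module K V] [Module A V] [IsScalarTower K A V] [FiniteDimensional K V]
    {ℳ : ℤ → Submodule K V} {E : Submodule K A}
    (hE : ∀ g ∈ E, ∀ k, ∀ v ∈ ℳ k, g • v ∈ ℳ (k + 1)) {a b : ℤ} {g h : A}
    (hg : g ∈ E) (hh : h ∈ E) (hSL : IsSLEndo K ℳ a b (mulMap K V g)) :
    {t : K | ¬ IsSLEndo K ℳ a b (mulMap K V (g + t • h))}.Finite := by
  have hpow : ∀ u ∈ E, ∀ (e : ℕ) (k : ℤ), ∀ v ∈ ℳ k, (mulMap K V u ^ e) v ∈ ℳ (k + e) := by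
    intro u hu e
    induction e with
    | zero => intro k v hv; simpa using hv
    | succ e ih =>
      intro k v hv
      rw [pow_succ', Module.End.mul_apply, mulMap_apply]
      have := hE u hu _ _ (ih k v hv)
      rwa [show k + ((e + 1 : ℕ) : ℤ) = k + e + 1 by push_cast; ring]
  have hmaps : ∀ u ∈ E, ∀ i : ℕ, 2 * (i : ℤ) ≤ b - a → ∀ v ∈ ℳ (a + i),
      (mulMap K V u ^ (b - a - 2 * i).toNat) v ∈ ℳ (b - i) := by
    intro u hu i hi v hv
    have := hpow u hu (b - a - 2 * i).toNat _ v hv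
    rwa [show a + (i : ℤ) + ((b - a - 2 * (i : ℤ)).toNat : ℤ) = b - i by omega] at this
  have hfr : ∀ i : ℕ, 2 * (i : ℤ) ≤ b - a →
      Module.finrank K (ℳ (a + i)) = Module.finrank K (ℳ (b - i)) := fun i hi =>
    finrank_eq_of_bijective (hmaps g hg i hi) (hSL i hi).1 (hSL i hi).2
  have hfin : ∀ i : ℕ, 2 * (i : ℤ) ≤ b - a → {t : K | ∃ x ∈ ℳ (a + i), x ≠ 0 ∧
      ((mulMap K V g + t • mulMap K V h) ^ (b - a - 2 * i).toNat) x = 0}.Finite := by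
    intro i hi
    refine finite_pencil_not_injective (commute_mulMap g h) (hfr i hi) ?_ (hSL i hi).1
    intro k hk x hx
    have := hpow g hg ((b - a - 2 * i).toNat - k) _ _ (hpow h hh k _ x hx)
    rwa [show a + (i : ℤ) + k + (((b - a - 2 * (i : ℤ)).toNat - k : ℕ) : ℤ) = b - i by omega]
      at this
  refine (Set.Finite.biUnion (Finset.finite_toSet ((Finset.range ((b - a).toNat + 1)).filter
    fun i : ℕ => 2 * (i : ℤ) ≤ b - a)) fun i hi => hfin i (Finset.mem_filter.mp hi).2).subset ?_
  intro t ht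
  by_contra hcon
  apply ht
  intro i hi
  have hinj : ∀ v ∈ ℳ (a + i),
      (mulMap K V (g + t • h) ^ (b - a - 2 * i).toNat) v = 0 → v = 0 := by
    intro v hv h0
    by_contra hv0
    apply hcon
    rw [Set.mem_iUnion₂]
    refine ⟨i, ?_, v, hv, hv0, by rw [← mulMap_add_smul]; exact h0⟩
    simp only [Finset.coe_filter, Finset.mem_range, Set.mem_ofPred_eq]
    omega
  exact ⟨hinj, exists_apply_eq_of_injective (hfr i hi)
    (hmaps _ (E.add_mem hg (E.smul_mem t hh)) i hi) hinj⟩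

/-- Finitely many properties, each inhabited and open along lines, have a common point. -/
theorem exists_forall_of_open {K A : Type} [Field K] [Infinite K] [AddCommGroup A] [Module K A]
    (E : Submodule K A) (P : ℕ → A → Prop) (hex : ∀ r, ∃ g ∈ E, P r g)
    (hopen : ∀ r, ∀ g ∈ E, ∀ h ∈ E, P r g → {t : K | ¬ P r (g + t • h)}.Finite) (N : ℕ) :
    ∃ g ∈ E, ∀ r < N, P r g := by
  induction N with
  | zero => exact ⟨0, zero_mem _, by simp⟩
  | succ N ih =>
    obtain ⟨g, hg, hgP⟩ := ih
    obtain ⟨h, hh, hhP⟩ := hex N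
    have h1 : (⋃ r ∈ Finset.range N, {t : K | ¬ P r (g + t • (h - g))}).Finite :=
      Set.Finite.biUnion (Finset.finite_toSet _) fun r hr =>
        hopen r g hg _ (E.sub_mem hh hg) (hgP r (Finset.mem_range.mp hr))
    have h2 : ((fun t : K => 1 - t) ⁻¹' {t : K | ¬ P N (h + t • (g - h))}).Finite :=
      (hopen N h hh _ (E.sub_mem hg hh) hhP).preimage (sub_right_injective.injOn)
    obtain ⟨t, ht⟩ := (h1.union h2).exists_notMem
    rw [Set.mem_union, not_or, Set.mem_iUnion₂] at ht
    refine ⟨g + t • (h - g), E.add_mem hg (E.smul_mem _ (E.sub_mem hh hg)), fun r hr => ?_⟩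
    rcases Nat.lt_succ_iff_lt_or_eq.mp hr with hr | rfl
    · by_contra hP
      exact ht.1 ⟨r, Finset.mem_range.mpr hr, hP⟩
    · by_contra hP
      apply ht.2
      change ¬ P r (h + (1 - t) • (g - h))
      rwa [show h + (1 - t) • (g - h) = g + t • (h - g) by module]

/-- The two ends of the support of a jump quotient add up to the degree predicted by duality. -/
theorem IsGorenstein.add_eq_of_gradedBetween {K A : Type} [Field K] [CommRing A] [Algebra K A]
    {𝒜 : ℕ → Submodule K A} {c : ℕ} (hA : IsGradedArtinAlg K 𝒜) (htop : GradedTop K 𝒜 c)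
    (hGor : IsGorenstein K 𝒜) {z : A} (hz : z ∈ 𝒜 1) {r m' : ℕ}
    (hm' : colonPlus K z m' = colonPlus K z r) {a b : ℤ}
    (hab : GradedBetween K (natToZ K (csGrading K 𝒜 z (r + 1) m')) a b) :
    a + b + r = c := by
  obtain ⟨hle, ha, hb, hout⟩ := hab
  have hdual : ∀ k : ℤ, natToZ K (csGrading K 𝒜 z (r + 1) m') k ≠ ⊥ →
      a ≤ c - r - k ∧ c - r - k ≤ b := by
    intro k hk
    have hk0 : 0 ≤ k := by
      by_contra h
      exact hk (natToZ_of_neg _ (not_le.mp h))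
    lift k to ℕ using hk0
    rw [natToZ_natCast, csGrading_ne_bot_iff, hm'] at hk
    obtain ⟨x, hx, hxm, hxr⟩ := hk
    obtain ⟨e, he, y, hy, hym, hyr⟩ := hGor.exists_dual_degree hA htop hz hx hxm hxr
    have hne : natToZ K (csGrading K 𝒜 z (r + 1) m') e ≠ ⊥ := by
      rw [natToZ_natCast, csGrading_ne_bot_iff, hm']
      exact ⟨y, hy, hym, hyr⟩
    by_contra hcon
    exact hne (hout e (by omega))
  have h1 := hdual a ha
  have h2 := hdual b hb
  omega

/-- If a vector of homogeneous elements satisfies the relations of `(g + z) ^ n` modulo the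
filtration `(0 : z ^ j) + z A`, and `g` is a strong Lefschetz element on every jump of that
filtration, then the vector lies in the filtration. -/
theorem mem_colonPlus_of_binomial_relations {K A : Type} [Field K] [CharZero K] [CommRing A]
    [Algebra K A] {𝒜 : ℕ → Submodule K A} {c : ℕ} (hA : IsGradedArtinAlg K 𝒜)
    (htop : GradedTop K 𝒜 c) (hGor : IsGorenstein K 𝒜) {z g : A} (hz : z ∈ 𝒜 1) (hg : g ∈ 𝒜 1)
    (hgood : ∀ r, ¬ colonPlus K z (r + 1) ≤ colonPlus K z r →
      ∃ m', colonPlus K z m' = colonPlus K z r ∧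
        ∃ a b, GradedBetween K (natToZ K (csGrading K 𝒜 z (r + 1) m')) a b ∧
          IsSLEndo K (natToZ K (csGrading K 𝒜 z (r + 1) m')) a b
            (mulMap K (CSMod K z (r + 1) m') g))
    {i n : ℕ} (hin : 2 * i + n = c) {y : ℕ → A} (hy : ∀ j ≤ i, y j ∈ 𝒜 (i - j))
    (hy0 : ∀ j, i < j → y j = 0)
    (hrel : ∀ j, ∑ k ∈ Finset.range (j + 1), (n.choose k : K) • (g ^ (n - k) * y (j - k)) ∈
      colonPlus K z j) (j : ℕ) : y j ∈ colonPlus K z j := by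
  have hmono := colonPlus_mono (K := K) z
  have key : ∀ s, ∀ j, y j ∈ colonPlus K z (max (c + 1 - s) j) := by
    intro s
    induction s with
    | zero =>
      intro j
      refine hmono (le_max_left _ _) (mem_colonPlus.mpr ⟨y j, 0, ?_, by simp⟩)
      rw [hA.pow_eq_zero htop hz (by omega), zero_mul]
    | succ s ih =>
      intro j
      by_cases hs : c + 1 ≤ s
      · rw [show c + 1 - (s + 1) = c + 1 - s by omega]
        exact ih j
      obtain ⟨r, hr⟩ : ∃ r, c + 1 - s = r + 1 := ⟨c - s, by omega⟩
      rw [show c + 1 - (s + 1) = r by omega]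
      rw [hr] at ih
      by_cases hjr : r < j
      · have := ih j
        rwa [max_eq_right (by omega)] at this ⊢
      rw [max_eq_left (by omega)]
      have hyr : ∀ l ≤ r, y l ∈ colonPlus K z (r + 1) := by
        intro l hl
        have := ih l
        rwa [max_eq_left (by omega)] at this
      by_cases hjump : colonPlus K z (r + 1) ≤ colonPlus K z r
      · exact hjump (hyr j (by omega))
      obtain ⟨m', hm', a, b, hab, hSL⟩ := hgood r hjump
      have hsum := hGor.add_eq_of_gradedBetween hA htop hz hm' hab
      classical
      let Y : ℕ → colonPlus K z (r + 1) := fun l =>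
        if h : y l ∈ colonPlus K z (r + 1) then ⟨y l, h⟩ else 0
      have hY : ∀ l ≤ r, (Y l : A) = y l := fun l hl => by
        simp only [Y]
        rw [dif_pos (hyr l hl)]
      have := hSL.tensor_truncated_injective (f := r + 1) (n := n) (i := i)
        (fun k v hv => smul_mem_natToZ_csGrading hA hg k hv) hab.2.2.2 (by push_cast; omega)
        (fun l => (Submodule.Quotient.mk (Y l) : CSMod K z (r + 1) m')) ?_ ?_ j (by omega)
      · rw [csMod_mk_eq_zero, hm', hY j (by omega)] at this
        exact this
      · intro l hl
        by_cases hli : l ≤ i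
        · rw [show (i : ℤ) - l = ((i - l : ℕ) : ℤ) by omega, natToZ_natCast]
          exact mem_csGrading.mpr ⟨Y l, by rw [hY l (by omega)]; exact hy l hli, rfl⟩
        · have : Y l = 0 := Subtype.ext (by rw [hY l (by omega), hy0 l (by omega)]; rfl)
          rw [this, Submodule.Quotient.mk_zero]
          exact zero_mem _
      · intro l hl
        have hsumeq : ∑ k ∈ Finset.range (l + 1), (n.choose k : K) •
            (mulMap K (CSMod K z (r + 1) m') g ^ (n - k)) (Submodule.Quotient.mk (Y (l - k))) =
            Submodule.Quotient.mk (∑ k ∈ Finset.range (l + 1),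
              (n.choose k : K) • (g ^ (n - k) • Y (l - k))) := by
          rw [← Submodule.mkQ_apply, map_sum]
          refine Finset.sum_congr rfl fun k _ => ?_
          rw [mulMap_pow_apply]
          rfl
        rw [hsumeq, csMod_mk_eq_zero, hm']
        refine hmono (show l ≤ r by omega) ?_
        convert hrel l using 1
        rw [AddSubmonoidClass.coe_finsetSum]
        refine Finset.sum_congr rfl fun k _ => ?_
        rw [← hY (l - k) (by omega)]
        rfl
  have := key (c + 1) j
  rwa [show max (c + 1 - (c + 1)) j = j by omega] at this

/-- If `g` is a strong Lefschetz element on every jump of the filtration `(0 : z ^ j) + z A`, then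
`g + t z` is a strong Lefschetz element in a given degree for all but finitely many `t`. -/
theorem IsGorenstein.finite_pencil {K A : Type} [Field K] [CharZero K] [CommRing A]
    [Algebra K A] {𝒜 : ℕ → Submodule K A} {c : ℕ} (hA : IsGradedArtinAlg K 𝒜)
    (htop : GradedTop K 𝒜 c) (hGor : IsGorenstein K 𝒜) {z g : A} (hz : z ∈ 𝒜 1) (hg : g ∈ 𝒜 1)
    (hgood : ∀ r, ¬ colonPlus K z (r + 1) ≤ colonPlus K z r →
      ∃ m', colonPlus K z m' = colonPlus K z r ∧
        ∃ a b, GradedBetween K (natToZ K (csGrading K 𝒜 z (r + 1) m')) a b ∧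
          IsSLEndo K (natToZ K (csGrading K 𝒜 z (r + 1) m')) a b
            (mulMap K (CSMod K z (r + 1) m') g))
    {i n : ℕ} (hin : 2 * i + n = c) :
    {t : K | ∃ x ∈ 𝒜 i, x ≠ 0 ∧ ((mulMap K A g + t • mulMap K A z) ^ n) x = 0}.Finite := by
  have : FiniteDimensional K A := hA.2.2.2.2
  by_contra hinf
  obtain ⟨v, M, hvi, -, hvM, ⟨j₀, hj₀⟩, hv⟩ := exists_pencil_kernel (commute_mulMap g z)
    (hGor.finrank_eq hA htop (show i + (i + n) = c by omega)) (n := n) (by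
      intro k hk x hx
      rw [mulMap_pow_apply, mulMap_pow_apply, show i + n = (n - k) + (k + i) by omega]
      exact hA.2.2.1 _ _ _ (hA.pow_mem hg _) _ (hA.2.2.1 _ _ _ (hA.pow_mem hz _) _ hx)) hinf
  simp only [mulMap_pow_apply, smul_eq_mul] at hv
  obtain ⟨π, hmem, hsame, -, -, hmul, hlt⟩ := hA.exists_proj
  have key : ∀ p κ : ℕ, ∃ y, v (κ + (M - p)) = z ^ κ * y := by
    intro p
    induction p with
    | zero => exact fun κ => ⟨0, by rw [hvM _ (by push_cast; omega), mul_zero]⟩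
    | succ p ih =>
      set r : ℤ := M - p with hr
      have hhom : ∀ κ : ℕ, ∃ y, (κ ≤ i → y ∈ 𝒜 (i - κ)) ∧ (i < κ → y = 0) ∧
          v (κ + r) = z ^ κ * y := by
        intro κ
        obtain ⟨y, hy⟩ := ih κ
        by_cases hκ : κ ≤ i
        · refine ⟨π (i - κ) y, fun _ => hmem _ _, fun h => absurd h (by omega), ?_⟩
          rw [← hmul κ _ (hA.pow_mem hz κ), ← hy, show κ + (i - κ) = i by omega, hsame _ _ (hvi _)]
        · refine ⟨0, fun h => absurd h hκ, fun _ => rfl, ?_⟩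
          rw [mul_zero, ← hsame i _ (hvi _), hy, hlt κ i (by omega) _ (hA.pow_mem hz κ)]
      choose y hyi hy0 hvy using hhom
      have hrel : ∀ κ, ∑ k ∈ Finset.range (κ + 1),
          (n.choose k : K) • (g ^ (n - k) * y (κ - k)) ∈ colonPlus K z κ := by
        intro κ
        let T : ℕ → A := fun k =>
          (n.choose k : K) • (g ^ (n - k) * (z ^ k * v (κ + r - k)))
        have hT : ∑ k ∈ Finset.range (κ + 1 + (n + 1)), T k = 0 := by
          rw [← hv (κ + r)]
          refine (Finset.sum_subset (Finset.range_mono (by omega)) fun k _ hk => ?_).symm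
          rw [Finset.mem_range, not_lt] at hk
          simp only [T]
          rw [Nat.choose_eq_zero_of_lt (by omega), Nat.cast_zero, zero_smul]
        rw [Finset.sum_range_add] at hT
        have h1 : ∑ k ∈ Finset.range (κ + 1), T k = z ^ κ * ∑ k ∈ Finset.range (κ + 1),
            (n.choose k : K) • (g ^ (n - k) * y (κ - k)) := by
          rw [Finset.mul_sum]
          refine Finset.sum_congr rfl fun k hk => ?_
          rw [Finset.mem_range] at hk
          simp only [T]
          rw [show (κ : ℤ) + r - k = ((κ - k : ℕ) : ℤ) + r by omega, hvy, mul_smul_comm]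
          congr 1
          rw [← mul_assoc (z ^ k), ← pow_add, show k + (κ - k) = κ by omega]
          ring
        obtain ⟨W, hW⟩ : ∃ W, ∑ k ∈ Finset.range (n + 1), T (κ + 1 + k) = z ^ κ * (z * W) := by
          refine ⟨∑ k ∈ Finset.range (n + 1), (n.choose (κ + 1 + k) : K) •
            (g ^ (n - (κ + 1 + k)) * (z ^ k * v (κ + r - (κ + 1 + k : ℕ)))), ?_⟩
          rw [← mul_assoc, Finset.mul_sum]
          refine Finset.sum_congr rfl fun k _ => ?_
          simp only [T]
          rw [mul_smul_comm]
          congr 1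
          ring
        rw [h1, hW, ← mul_add] at hT
        exact mem_colonPlus.mpr ⟨_, -W, hT, by ring⟩
      intro κ
      rcases κ with _ | κ
      · exact ⟨_, by rw [pow_zero, one_mul]⟩
      obtain ⟨x', w, h0, hw⟩ := mem_colonPlus.mp
        (mem_colonPlus_of_binomial_relations hA htop hGor hz hg hgood hin hyi hy0 hrel κ)
      refine ⟨w, ?_⟩
      rw [show ((κ + 1 : ℕ) : ℤ) + (M - (p + 1 : ℕ)) = κ + r by push_cast; omega, hvy, hw, mul_add,
        h0, zero_add, pow_succ, mul_assoc]
  have hlt : j₀ < M := by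
    by_contra h
    exact hj₀ (hvM j₀ (not_lt.mp h))
  obtain ⟨y, hy⟩ := key (c + 1 + M - j₀).toNat (c + 1)
  apply hj₀
  rw [show j₀ = ((c + 1 : ℕ) : ℤ) + (M - ((c + 1 + M - j₀).toNat : ℤ)) by push_cast; omega, hy,
    hA.pow_eq_zero htop hz (by omega), zero_mul]

/-- A common strong Lefschetz element of the jumps of the filtration `(0 : z ^ j) + z A` gives a
strong Lefschetz element of the algebra. -/
theorem IsGorenstein.exists_isAlgSLElem {K A : Type} [Field K] [CharZero K] [CommRing A]
    [Algebra K A] {𝒜 : ℕ → Submodule K A} {c : ℕ} (hA : IsGradedArtinAlg K 𝒜)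
    (htop : GradedTop K 𝒜 c) (hGor : IsGorenstein K 𝒜) {z g : A} (hz : z ∈ 𝒜 1) (hg : g ∈ 𝒜 1)
    (hgood : ∀ r, ¬ colonPlus K z (r + 1) ≤ colonPlus K z r →
      ∃ m', colonPlus K z m' = colonPlus K z r ∧
        ∃ a b, GradedBetween K (natToZ K (csGrading K 𝒜 z (r + 1) m')) a b ∧
          IsSLEndo K (natToZ K (csGrading K 𝒜 z (r + 1) m')) a b
            (mulMap K (CSMod K z (r + 1) m') g)) :
    ∃ g' : A, IsAlgSLElem K 𝒜 c g' := by
  have : FiniteDimensional K A := hA.2.2.2.2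
  have hfin : (⋃ i ∈ (Finset.range (c + 1)).filter fun i => 2 * i ≤ c, {t : K | ∃ x ∈ 𝒜 i,
      x ≠ 0 ∧ ((mulMap K A g + t • mulMap K A z) ^ (c - 2 * i)) x = 0}).Finite :=
    Set.Finite.biUnion (Finset.finite_toSet _) fun i hi =>
      hGor.finite_pencil hA htop hz hg hgood (by
        have := (Finset.mem_filter.mp (Finset.mem_coe.mp hi)).2
        omega)
  obtain ⟨t, ht⟩ := hfin.exists_notMem
  have hgt : g + t • z ∈ 𝒜 1 := (𝒜 1).add_mem hg ((𝒜 1).smul_mem t hz)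
  refine ⟨g + t • z, hgt, fun i hi => ?_⟩
  have hinj : ∀ v ∈ 𝒜 i, (g + t • z) ^ (c - 2 * i) * v = 0 → v = 0 := by
    intro v hv h0
    by_contra hv0
    apply ht
    rw [Set.mem_iUnion₂]
    refine ⟨i, by simp only [Finset.mem_filter, Finset.mem_range]; omega, v, hv, hv0, ?_⟩
    rw [← mulMap_add_smul, mulMap_pow_apply]
    exact h0
  refine ⟨hinj, ?_⟩
  have := exists_apply_eq_of_injective (F := mulMap K A (g + t • z) ^ (c - 2 * i))
    (hGor.finrank_eq hA htop (show i + (c - i) = c by omega)) (fun x hx => by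
      rw [mulMap_pow_apply, show c - i = (c - 2 * i) + i by omega]
      exact hA.2.2.1 _ _ _ (hA.pow_mem hgt _) _ hx) (fun x hx h0 => hinj x hx (by
      rw [mulMap_pow_apply] at h0
      exact h0))
  simpa only [mulMap_pow_apply, smul_eq_mul] using this

/-- Jumps of the filtration `(0 : z ^ j) + z A` with the strong Lefschetz property have a common
strong Lefschetz element. -/
theorem exists_common_isSLEndo {K A : Type} [Field K] [CharZero K] [CommRing A]
    [Algebra K A] {𝒜 : ℕ → Submodule K A} {c : ℕ} (hA : IsGradedArtinAlg K 𝒜)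
    (htop : GradedTop K 𝒜 c) {z : A} (hz : z ∈ 𝒜 1) {m : ℕ → ℕ}
    (hSLP : ∀ r, ¬ colonPlus K z (r + 1) ≤ colonPlus K z r →
      PiecesHasSLP K 𝒜 (natToZ K (csGrading K 𝒜 z (r + 1) (m r)))) :
    ∃ g ∈ 𝒜 1, ∀ r, ¬ colonPlus K z (r + 1) ≤ colonPlus K z r →
      ∃ a b, GradedBetween K (natToZ K (csGrading K 𝒜 z (r + 1) (m r))) a b ∧
        IsSLEndo K (natToZ K (csGrading K 𝒜 z (r + 1) (m r))) a b
          (mulMap K (CSMod K z (r + 1) (m r)) g) := by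
  have : FiniteDimensional K A := hA.2.2.2.2
  let P : ℕ → A → Prop := fun r g => ¬ colonPlus K z (r + 1) ≤ colonPlus K z r →
    ∃ a b, GradedBetween K (natToZ K (csGrading K 𝒜 z (r + 1) (m r))) a b ∧
      IsSLEndo K (natToZ K (csGrading K 𝒜 z (r + 1) (m r))) a b
        (mulMap K (CSMod K z (r + 1) (m r)) g)
  have hex : ∀ r, ∃ g ∈ 𝒜 1, P r g := by
    intro r
    by_cases hr : colonPlus K z (r + 1) ≤ colonPlus K z r
    · exact ⟨0, zero_mem _, fun h => absurd hr h⟩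
    · obtain ⟨a, b, hab, g, hg, hSL⟩ := hSLP r hr
      exact ⟨g, hg, fun _ => ⟨a, b, hab, hSL⟩⟩
  have hopen : ∀ r, ∀ g ∈ 𝒜 1, ∀ h ∈ 𝒜 1, P r g → {t : K | ¬ P r (g + t • h)}.Finite := by
    intro r g hg h hh hP
    by_cases hr : colonPlus K z (r + 1) ≤ colonPlus K z r
    · simp [P, hr]
    · obtain ⟨a, b, hab, hSL⟩ := hP hr
      have := csMod_finiteDimensional (K := K) z (r + 1) (m r)
      exact (IsSLEndo.finite_not (fun u hu k v hv => smul_mem_natToZ_csGrading hA hu k hv)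
        hg hh hSL).subset fun t ht hcon => ht fun _ => ⟨a, b, hab, hcon⟩
  obtain ⟨g, hg, hgP⟩ := exists_forall_of_open (𝒜 1) P hex hopen (c + 1)
  refine ⟨g, hg, fun r hr => hgP r ?_ hr⟩
  by_contra hrc
  refine hr fun x _ => mem_colonPlus.mpr ⟨x, 0, ?_, by simp⟩
  rw [hA.pow_eq_zero htop hz (by omega), zero_mul]

theorem exists_distinctSizes (d : Multiset ℕ) :
    ∃ (s : ℕ) (f : Fin s → ℕ), DistinctSizes d f := by
  refine ⟨d.toFinset.card, fun i => d.toFinset.orderEmbOfFin rfl i.rev, fun i j hij => ?_,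
    fun n => ?_⟩
  · exact (d.toFinset.orderEmbOfFin rfl).strictMono (Fin.rev_lt_rev.mpr hij)
  · have := Set.ext_iff.mp (d.toFinset.range_orderEmbOfFin rfl) n
    rw [Finset.mem_coe, Multiset.mem_toFinset, Set.mem_range] at this
    rw [← this]
    exact ⟨fun ⟨i, hi⟩ => ⟨i.rev, hi⟩, fun ⟨i, hi⟩ => ⟨i.rev, by simpa only [Fin.rev_rev] using hi⟩⟩

theorem DistinctSizes.nextSize_lt {d : Multiset ℕ} {s : ℕ} {f : Fin s → ℕ}
    (hf : DistinctSizes d f) (hd : ∀ n ∈ d, 0 < n) (i : Fin s) : nextSize f i < f i := by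
  unfold nextSize
  split_ifs with h
  · exact hf.1 (Fin.mk_lt_mk.mpr (Nat.lt_succ_self _))
  · exact hd _ ((hf.2 _).mp ⟨i, rfl⟩)

theorem DistinctSizes.eq_of_nextSize_lt {d : Multiset ℕ} {s : ℕ} {f : Fin s → ℕ}
    (hf : DistinctSizes d f) {i : Fin s} {n : ℕ} (hn : n ∈ d) (h1 : nextSize f i < n)
    (h2 : n ≤ f i) : n = f i := by
  obtain ⟨k, rfl⟩ := (hf.2 n).mpr hn
  have hik : i ≤ k := hf.1.le_iff_ge.mp h2
  have hki : (k : ℕ) ≤ i := by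
    by_contra hlt
    have hs : (i : ℕ) + 1 < s := by omega
    rw [nextSize, dif_pos hs] at h1
    have := hf.1.lt_iff_gt.mp h1
    rw [Fin.lt_def] at this
    simp at this
    omega
  rw [le_antisymm (Fin.le_def.mpr hki) hik]

theorem DistinctSizes.colonPlus_nextSize_eq {K A : Type} [Field K] [CommRing A] [Algebra K A]
    [FiniteDimensional K A] {z : A} {d : Multiset ℕ} (hd : IsJordanType K (mulMap K A z) d)
    {s : ℕ} {f : Fin s → ℕ} (hf : DistinctSizes d f) {i : Fin s} {r : ℕ} (hr : f i = r + 1) :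
    colonPlus K z (nextSize f i) = colonPlus K z r := by
  have hlt := hf.nextSize_lt hd.1 i
  refine le_antisymm (colonPlus_mono (K := K) z (by omega)) ?_
  have key : ∀ n, nextSize f i ≤ n → n ≤ r → colonPlus K z n ≤ colonPlus K z (nextSize f i) := by
    intro n hn
    induction n, hn using Nat.le_induction with
    | base => exact fun _ => le_rfl
    | succ n hn ih =>
      intro hnr
      refine le_trans ?_ (ih (by omega))
      by_contra hcon
      have := hf.eq_of_nextSize_lt (i := i) ((hd.succ_mem_iff n).mpr hcon) (by omega) (by omega)
      omega
  exact key r (by omega) le_rfl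

/-- Lefschetz elements for all central simple modules give one for the algebra. -/
theorem IsGorenstein.exists_isAlgSLElem_of_centralSimple {K A : Type} [Field K] [CharZero K]
    [CommRing A] [Algebra K A] {𝒜 : ℕ → Submodule K A} {c : ℕ} (hA : IsGradedArtinAlg K 𝒜)
    (htop : GradedTop K 𝒜 c) (hGor : IsGorenstein K 𝒜) {z : A} (hz : z ∈ 𝒜 1)
    {d : Multiset ℕ} (hd : IsJordanType K (mulMap K A z) d) {s : ℕ} {f : Fin s → ℕ}
    (hf : DistinctSizes d f)
    (hSLP : ∀ i : Fin s, PiecesHasSLP K 𝒜 (natToZ K (csGrading K 𝒜 z (f i) (nextSize f i)))) :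
    ∃ g : A, IsAlgSLElem K 𝒜 c g := by
  have : FiniteDimensional K A := hA.2.2.2.2
  have hex : ∀ r, ∃ m', ¬ colonPlus K z (r + 1) ≤ colonPlus K z r →
      colonPlus K z m' = colonPlus K z r ∧
        PiecesHasSLP K 𝒜 (natToZ K (csGrading K 𝒜 z (r + 1) m')) := by
    intro r
    by_cases hr : colonPlus K z (r + 1) ≤ colonPlus K z r
    · exact ⟨0, fun h => absurd hr h⟩
    · obtain ⟨i, hi⟩ := (hf.2 _).mpr ((hd.succ_mem_iff r).mpr hr)
      refine ⟨nextSize f i, fun _ => ⟨hf.colonPlus_nextSize_eq hd hi, ?_⟩⟩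
      rw [← hi]
      exact hSLP i
  choose m hm using hex
  obtain ⟨g, hg, hgood⟩ := exists_common_isSLEndo hA htop hz fun r hr => (hm r hr).2
  exact hGor.exists_isAlgSLElem hA htop hz hg fun r hr => ⟨m r, (hm r hr).1, hgood r hr⟩

/-- For a strong Lefschetz element `g`, a generator modulo `g` of degree `δ` belongs to the jump
`c - 2 δ` of the filtration `(0 : g ^ j) + g A`. -/
theorem IsAlgSLElem.jump_of_notMem {K A : Type} [Field K] [CommRing A] [Algebra K A]
    {𝒜 : ℕ → Submodule K A} {c : ℕ} (hA : IsGradedArtinAlg K 𝒜) (htop : GradedTop K 𝒜 c) {g : A}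
    (hg : IsAlgSLElem K 𝒜 c g) {δ : ℕ} {x : A} (hx : x ∈ 𝒜 δ) (hxg : ∀ y, x ≠ g * y) :
    2 * δ ≤ c ∧ x ∈ colonPlus K g (c - 2 * δ + 1) ∧ x ∉ colonPlus K g (c - 2 * δ) := by
  obtain ⟨hg1, hSL⟩ := hg
  have hδ : 2 * δ ≤ c := by
    by_contra hlt
    by_cases hδc : δ ≤ c
    · obtain ⟨w, -, hw⟩ := (hSL (c - δ) (by omega)).2 x (by
        rwa [show c - (c - δ) = δ by omega])
      obtain ⟨e, he⟩ : ∃ e, c - 2 * (c - δ) = e + 1 := ⟨c - 2 * (c - δ) - 1, by omega⟩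
      exact hxg (g ^ e * w) (by rw [← hw, he, pow_succ', mul_assoc])
    · rw [htop.2 δ (by omega), Submodule.mem_bot] at hx
      exact hxg 0 (by rw [hx, mul_zero])
  refine ⟨hδ, ?_, fun h => ?_⟩
  · rcases δ with _ | δ
    · refine mem_colonPlus.mpr ⟨x, 0, ?_, by simp⟩
      rw [hA.pow_eq_zero htop hg1 (by omega), zero_mul]
    · obtain ⟨w, -, hw⟩ := (hSL δ (by omega)).2 (g ^ (c - 2 * (δ + 1) + 1) * x) (by
        rw [show c - δ = (c - 2 * (δ + 1) + 1) + (δ + 1) by omega]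
        exact hA.2.2.1 _ _ _ (hA.pow_mem hg1 _) _ hx)
      refine mem_colonPlus.mpr ⟨x - g * w, w, ?_, by ring⟩
      rw [mul_sub, ← hw, show c - 2 * δ = (c - 2 * (δ + 1) + 1) + 1 by omega]
      ring
  · obtain ⟨x', hx', y, h0, rfl⟩ := hA.exists_mem_of_mem_colonPlus hg1 hx h
    exact hxg y (by rw [(hSL δ hδ).1 x' hx' h0, zero_add])

/-- The central simple modules of a strong Lefschetz element are concentrated in one degree. -/
theorem IsAlgSLElem.piecesHasSLP_centralSimple {K A : Type} [Field K] [CommRing A] [Algebra K A]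
    {𝒜 : ℕ → Submodule K A} {c : ℕ} (hA : IsGradedArtinAlg K 𝒜) (htop : GradedTop K 𝒜 c) {g : A}
    (hg : IsAlgSLElem K 𝒜 c g) {d : Multiset ℕ} (hd : IsJordanType K (mulMap K A g) d) {s : ℕ}
    {f : Fin s → ℕ} (hf : DistinctSizes d f) (i : Fin s) :
    PiecesHasSLP K 𝒜 (natToZ K (csGrading K 𝒜 g (f i) (nextSize f i))) := by
  have : FiniteDimensional K A := hA.2.2.2.2
  have hlt := hf.nextSize_lt hd.1 i
  have hmono := colonPlus_mono (K := K) g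
  have key : ∀ δ, ∀ x ∈ 𝒜 δ, x ∈ colonPlus K g (f i) → x ∉ colonPlus K g (nextSize f i) →
      2 * δ ≤ c ∧ c - 2 * δ + 1 = f i := by
    intro δ x hx hxm hxm'
    obtain ⟨hδ, h1, h2⟩ := hg.jump_of_notMem hA htop hx fun y hy =>
      hxm' (by rw [hy]; exact mul_mem_colonPlus g _ y)
    refine ⟨hδ, hf.eq_of_nextSize_lt ((hd.succ_mem_iff _).mpr fun hle => h2 (hle h1)) ?_ ?_⟩
    · by_contra hcon
      exact hxm' (hmono (by omega) h1)
    · by_contra hcon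
      exact h2 (hmono (by omega) hxm)
  have hjump : ¬ colonPlus K g (f i) ≤ colonPlus K g (nextSize f i) := by
    obtain ⟨r, hr⟩ : ∃ r, f i = r + 1 := ⟨f i - 1, by omega⟩
    rw [hf.colonPlus_nextSize_eq hd hr, hr]
    exact (hd.succ_mem_iff r).mp (hr ▸ (hf.2 _).mp ⟨i, rfl⟩)
  obtain ⟨δ, x, hx, hxm, hxm'⟩ := hA.exists_mem_notMem_of_not_le hg.1 hjump
  obtain ⟨hδ, hδi⟩ := key δ x hx hxm hxm'
  have hne : natToZ K (csGrading K 𝒜 g (f i) (nextSize f i)) δ ≠ ⊥ := by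
    rw [natToZ_natCast, csGrading_ne_bot_iff]
    exact ⟨x, hx, hxm, hxm'⟩
  refine ⟨δ, δ, ⟨le_rfl, hne, hne, fun k hk => ?_⟩, g, hg.1, fun j hj => ?_⟩
  · by_cases hk0 : k < 0
    · exact natToZ_of_neg _ hk0
    · lift k to ℕ using not_lt.mp hk0
      rw [natToZ_natCast]
      by_contra hcon
      obtain ⟨y, hy, hym, hym'⟩ := csGrading_ne_bot_iff.mp hcon
      obtain ⟨h1, h2⟩ := key k y hy hym hym'
      omega
  · obtain rfl : j = 0 := by omega
    simp

/-- Theorem 5.4. Let `K` be a field of characteristic zero and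
`A` a graded Artinian Gorenstein `K`-algebra.  Then `A` has the SLP if and only
if there is a linear form `z ∈ A₁` such that all central simple modules `U_i` of
`(A, z)` have the SLP. -/
theorem statement_10 {K A : Type} [Field K] [CharZero K] [CommRing A] [Algebra K A]
    (𝒜 : ℕ → Submodule K A) (c : ℕ)
    (hA : IsGradedArtinAlg K 𝒜) (htop : GradedTop K 𝒜 c)
    (hGor : IsGorenstein K 𝒜) :
    (∃ g : A, IsAlgSLElem K 𝒜 c g) ↔
      (∃ z ∈ 𝒜 1, ∀ d : Multiset ℕ, IsJordanType K (mulMap K A z) d →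
        ∀ (s : ℕ) (f : Fin s → ℕ), DistinctSizes d f →
          ∀ i : Fin s,
            PiecesHasSLP K 𝒜
              (natToZ K (csGrading K 𝒜 z (f i) (nextSize f i)))) := by
  constructor
  · rintro ⟨g, hg⟩
    exact ⟨g, hg.1, fun d hd s f hf i => hg.piecesHasSLP_centralSimple hA htop hd hf i⟩
  · rintro ⟨z, hz, h⟩
    have : FiniteDimensional K A := hA.2.2.2.2
    obtain ⟨d, hd⟩ := exists_isJordanType (K := K)
      ⟨c + 1, hA.pow_eq_zero htop hz (Nat.lt_succ_self c)⟩
    obtain ⟨s, f, hf⟩ := exists_distinctSizes d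
    exact hGor.exists_isAlgSLElem_of_centralSimple hA htop hz hd hf (h d hd s f hf)
end

section
/- Let K be a field of characteristic zero, B a graded Artinian K-algebra with maximal graded ideal m = ⊕_{i≥1} B_i, and A a graded Artinian K-algebra which is a flat (equivalently, finite free) B-module via a grade-preserving K-algebra homomorphism φ : B → A. If both B and the fiber A/mA have the SLP, then A has the SLP. -/
set_option maxHeartbeats 1000000
set_option synthInstance.maxHeartbeats 400000

open TensorProduct

section Fiber

variable (K : Type) [Field K]

/-- The extension `mA` of the graded maximal ideal `m = ⊕_{i≥1} B_i` of `B`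
to `A` along `φ`. -/
noncomputable def fiberIdeal {B A : Type} [CommRing B] [Algebra K B]
    [CommRing A] [Algebra K A] (ℬ : ℕ → Submodule K B) (φ : B →ₐ[K] A) : Ideal A :=
  Ideal.span (⋃ i ∈ Set.Ici 1, (φ '' (ℬ i : Set B)))

/-- The grading of the fiber `A/mA` induced by that of `A`. -/
noncomputable def fiberGrading {B A : Type} [CommRing B] [Algebra K B]
    [CommRing A] [Algebra K A] (ℬ : ℕ → Submodule K B) (φ : B →ₐ[K] A)
    (𝒜 : ℕ → Submodule K A) (i : ℕ) : Submodule K (A ⧸ fiberIdeal K ℬ φ) :=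
  Submodule.map (Ideal.Quotient.mkₐ K (fiberIdeal K ℬ φ)).toLinearMap (𝒜 i)

end Fiber

section SlTwo

variable {K U : Type*} [Field K] [AddCommGroup U] [Module K U]

/-- The defining relations of an `sl₂`-triple of endomorphisms of a vector space. -/
structure IsSlTwo (e f h : Module.End K U) : Prop where
  ef : e * f - f * e = h
  he : h * e - e * h = (2 : K) • e
  hf : h * f - f * h = -((2 : K) • f)

namespace IsSlTwo

variable {e f h : Module.End K U}

theorem symm (t : IsSlTwo e f h) : IsSlTwo f e (-h) where
  ef := by rw [← t.ef]; abel
  he := by rw [neg_mul, mul_neg, ← neg_neg ((2 : K) • f), ← t.hf]; abel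
  hf := by rw [neg_mul, mul_neg, ← t.he]; abel

theorem h_e (t : IsSlTwo e f h) (v : U) : h (e v) = e (h v) + (2 : K) • e v := by
  have := congrArg (fun x : Module.End K U => x v) t.he
  simp only [LinearMap.sub_apply, Module.End.mul_apply, LinearMap.smul_apply] at this
  rw [← this]; abel

theorem h_f (t : IsSlTwo e f h) (v : U) : h (f v) = f (h v) - (2 : K) • f v := by
  have := congrArg (fun x : Module.End K U => x v) t.hf
  simp only [LinearMap.sub_apply, Module.End.mul_apply, LinearMap.smul_apply,
    LinearMap.neg_apply] at this
  rw [sub_eq_add_neg, ← this]; abel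

theorem e_f (t : IsSlTwo e f h) (v : U) : e (f v) = f (e v) + h v := by
  have := congrArg (fun x : Module.End K U => x v) t.ef
  simp only [LinearMap.sub_apply, Module.End.mul_apply] at this
  rw [← this]; abel

theorem h_e_pow (t : IsSlTwo e f h) {v : U} {μ : K} (hv : h v = μ • v) (j : ℕ) :
    h ((e ^ j) v) = (μ + 2 * j) • (e ^ j) v := by
  induction j with
  | zero => simpa using hv
  | succ j ih =>
    rw [pow_succ', Module.End.mul_apply, t.h_e, ih, map_smul, ← add_smul]
    congr 1; push_cast; ring

theorem h_f_pow (t : IsSlTwo e f h) {v : U} {μ : K} (hv : h v = μ • v) (j : ℕ) :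
    h ((f ^ j) v) = (μ - 2 * j) • (f ^ j) v := by
  induction j with
  | zero => simpa using hv
  | succ j ih =>
    rw [pow_succ', Module.End.mul_apply, t.h_f, ih, map_smul, ← sub_smul]
    congr 1; push_cast; ring

/-- The (rescaled) Casimir element. -/
def casimir (_ : IsSlTwo e f h) : Module.End K U := (4 : K) • (f * e) + h * h + (2 : K) • h

theorem casimir_apply (t : IsSlTwo e f h) (v : U) :
    t.casimir v = (4 : K) • f (e v) + h (h v) + (2 : K) • h v := by
  simp [casimir]

theorem casimir_e (t : IsSlTwo e f h) (v : U) : t.casimir (e v) = e (t.casimir v) := by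
  have h1 := t.e_f (e v)
  have h2 := t.h_e v
  simp only [casimir_apply, map_add, map_smul, h1, h2, t.h_e]
  module

theorem casimir_f (t : IsSlTwo e f h) (v : U) : t.casimir (f v) = f (t.casimir v) := by
  simp only [casimir_apply, map_add, map_smul, t.e_f, t.h_f, map_sub]
  module

theorem casimir_h (t : IsSlTwo e f h) (v : U) : t.casimir (h v) = h (t.casimir v) := by
  simp only [casimir_apply, map_add, map_smul, t.h_e, t.h_f]
  module

theorem casimir_e_pow (t : IsSlTwo e f h) (j : ℕ) (v : U) :
    t.casimir ((e ^ j) v) = (e ^ j) (t.casimir v) := by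
  induction j with
  | zero => simp
  | succ j ih => rw [pow_succ', Module.End.mul_apply, t.casimir_e, ih, Module.End.mul_apply]

theorem casimir_f_pow (t : IsSlTwo e f h) (j : ℕ) (v : U) :
    t.casimir ((f ^ j) v) = (f ^ j) (t.casimir v) := by
  induction j with
  | zero => simp
  | succ j ih => rw [pow_succ', Module.End.mul_apply, t.casimir_f, ih, Module.End.mul_apply]

/-- In a vector of weight `-n`, the Casimir element has no eigenvalue belonging to a simple
module of highest weight smaller than `n`. -/
theorem eq_zero_of_casimir [CharZero K] [FiniteDimensional K U] (t : IsSlTwo e f h) {n i : ℕ}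
    (hi : i < n)
    {w : U} (hw : h w = (-(n : K)) • w)
    (hc : t.casimir w = ((-(n : K) + 2 * i) * (-(n : K) + 2 * i + 2)) • w) : w = 0 := by
  by_contra hne
  have key : ∀ k : ℕ, (f ^ k) w ≠ 0 := by
    intro k
    induction k with
    | zero => simpa using hne
    | succ k ih =>
      intro h0
      have hk := t.h_f_pow hw k
      have hck := t.casimir_f_pow k w
      rw [hc, map_smul] at hck
      rw [casimir_apply] at hck
      have h1 := t.e_f ((f ^ k) w)
      rw [← Module.End.mul_apply f, ← pow_succ', h0, map_zero] at h1
      have h2 : f (e ((f ^ k) w)) = -h ((f ^ k) w) := eq_neg_of_add_eq_zero_left h1.symm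
      rw [h2, hk, map_smul, hk] at hck
      have h3 : (4 * (((i : K) - n - k) * (i + k + 1))) • (f ^ k) w = 0 := by
        rw [← sub_eq_zero] at hck
        rw [← neg_eq_zero, ← hck]
        module
      rcases smul_eq_zero.1 h3 with h4 | h4
      · have h5 : ((i : K) + k + 1) ≠ 0 := by exact_mod_cast Nat.succ_ne_zero (i + k)
        have h6 : ((i : K) - n - k) ≠ 0 := by
          intro h7
          have : (i : K) = ((n + k : ℕ) : K) := by push_cast; linear_combination h7
          have := Nat.cast_injective this
          omega
        simp [h5, h6] at h4
      · exact ih h4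
  have hfin := Module.End.finite_hasEigenvalue h
  refine Set.infinite_of_injective_forall_mem (f := fun k : ℕ => -(n : K) - 2 * k) ?_ ?_ hfin
  · intro a b hab
    have : (a : K) = b := by
      have h2 : (2 : K) ≠ 0 := two_ne_zero
      apply mul_left_cancel₀ h2
      simp only at hab
      linear_combination -hab
    exact_mod_cast this
  · intro k
    exact Module.End.hasEigenvalue_of_hasEigenvector
      ⟨Module.End.mem_eigenspace_iff.2 (t.h_f_pow hw k), key k⟩

/-- The strong Lefschetz property of the raising operator of an `sl₂`-triple. -/
theorem eq_zero_of_e_pow [CharZero K] [FiniteDimensional K U] (t : IsSlTwo e f h) {n : ℕ} {v : U}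
    (hv : h v = (-(n : K)) • v) (h0 : (e ^ n) v = 0) : v = 0 := by
  have : ∀ j ≤ n, ∀ v : U, h v = (-(n : K)) • v → (e ^ j) v = 0 → v = 0 := by
    intro j
    induction j with
    | zero => intro _ v _ h0; simpa using h0
    | succ j ih =>
      intro hj v hv h0
      apply t.eq_zero_of_casimir (i := j) (by omega) hv
      rw [← sub_eq_zero]
      apply ih (by omega)
      · rw [map_sub, ← t.casimir_h, map_smul, hv]
        simp only [map_smul]
        module
      · rw [map_sub, ← t.casimir_e_pow, map_smul, casimir_apply, ← Module.End.mul_apply e,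
          ← pow_succ', h0, t.h_e_pow hv, map_smul, t.h_e_pow hv]
        simp only [map_zero]
        module
  exact this n le_rfl v hv h0

theorem finrank_le [CharZero K] [FiniteDimensional K U] (t : IsSlTwo e f h) (n : ℕ) :
    Module.finrank K (h.eigenspace (n : K)) ≤ Module.finrank K (h.eigenspace (-(n : K))) := by
  have hm : ∀ v ∈ h.eigenspace (n : K), (f ^ n) v ∈ h.eigenspace (-(n : K)) := by
    intro v hv
    rw [Module.End.mem_eigenspace_iff] at hv ⊢
    rw [t.h_f_pow hv]; congr 1; ring
  refine LinearMap.finrank_le_finrank_of_injective (f := (f ^ n).restrict hm) ?_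
  rw [injective_iff_map_eq_zero]
  rintro ⟨v, hv⟩ h0
  rw [Module.End.mem_eigenspace_iff] at hv
  have h1 : (f ^ n) v = 0 := congrArg Subtype.val h0
  have := t.symm.eq_zero_of_e_pow (n := n) (v := v) (by simp [hv]) h1
  exact Subtype.ext this

end IsSlTwo

end SlTwo

section Trace

variable {K V : Type*} [Field K] [AddCommGroup V] [Module K V] [FiniteDimensional K V]

theorem exists_trace_mul_eq (ψ : Module.Dual K (Module.End K V)) :
    ∃ y : Module.End K V, ∀ x, ψ x = LinearMap.trace K V (y * x) := by
  let T : Module.End K V →ₗ[K] Module.Dual K (Module.End K V) :=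
    (LinearMap.mul K (Module.End K V)).compr₂ (LinearMap.trace K V)
  have hT : Function.Injective T := by
    rw [injective_iff_map_eq_zero]
    intro y hy
    ext v
    rw [LinearMap.zero_apply, ← Module.forall_dual_apply_eq_zero_iff K]
    intro ξ
    have := congrArg (fun z : Module.Dual K (Module.End K V) => z (ξ.smulRight v)) hy
    simp only [T, LinearMap.compr₂_apply, LinearMap.mul_apply', LinearMap.zero_apply] at this
    rw [← LinearMap.trace_smulRight, ← this]
    congr 1
    ext; simp
  have hs : Function.Surjective T :=
    (LinearMap.injective_iff_surjective_of_finrank_eq_finrank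
      (Subspace.dual_finrank_eq (K := K) (V := Module.End K V)).symm).1 hT
  obtain ⟨y, hy⟩ := hs ψ
  exact ⟨y, fun x => by rw [← hy]; rfl⟩

/-- An endomorphism which is trace-orthogonal to the centralizer of `e` is a commutator
with `e`. -/
theorem exists_commutator_eq (e h : Module.End K V)
    (H : ∀ y : Module.End K V, e * y = y * e → LinearMap.trace K V (h * y) = 0) :
    ∃ f : Module.End K V, e * f - f * e = h := by
  let ad : Module.End K V →ₗ[K] Module.End K V := LinearMap.mulLeft K e - LinearMap.mulRight K e
  by_contra hc
  have hn : h ∉ LinearMap.range ad := by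
    rintro ⟨f, hf⟩
    exact hc ⟨f, by simpa [ad] using hf⟩
  obtain ⟨ψ, hψ, hle⟩ := Submodule.exists_le_ker_of_notMem hn
  obtain ⟨y, hy⟩ := exists_trace_mul_eq ψ
  have hcomm : e * y = y * e := by
    obtain ⟨T, hT⟩ : ∃ T : Module.End K V, T = y * e - e * y := ⟨_, rfl⟩
    have hz : ∀ x, LinearMap.trace K V ((y * e - e * y) * x) = 0 := by
      intro x
      have h1 : ψ (ad x) = 0 := hle ⟨x, rfl⟩
      rw [hy] at h1
      simp only [ad, LinearMap.sub_apply, LinearMap.mulLeft_apply, LinearMap.mulRight_apply,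
        mul_sub, map_sub] at h1
      rw [sub_mul, map_sub, ← h1, ← mul_assoc y x e, LinearMap.trace_mul_comm K (y * x) e]
      simp only [mul_assoc]
    have : y * e - e * y = 0 := by
      ext v
      rw [LinearMap.zero_apply, ← Module.forall_dual_apply_eq_zero_iff K]
      intro ξ
      rw [← LinearMap.trace_smulRight, ← hz (ξ.smulRight v)]
      congr 1
      ext; simp
    exact (sub_eq_zero.1 this).symm
  apply hψ
  rw [hy, LinearMap.trace_mul_comm]
  exact H y hcomm

end Trace

section Grading

variable {K V : Type*} [Field K] [AddCommGroup V] [Module K V]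

/-- `π` is the family of projections onto the pieces of the grading `𝒱`. -/
structure IsGradProj (𝒱 : ℕ → Submodule K V) (π : ℕ → Module.End K V) : Prop where
  mem : ∀ i v, π i v ∈ 𝒱 i
  same : ∀ i, ∀ v ∈ 𝒱 i, π i v = v
  ne : ∀ i j, ∀ v ∈ 𝒱 j, i ≠ j → π i v = 0
  top : ⨆ i, 𝒱 i = ⊤

theorem DirectSum.IsInternal.exists_isGradProj {𝒱 : ℕ → Submodule K V}
    (h : DirectSum.IsInternal 𝒱) : ∃ π, IsGradProj 𝒱 π := by
  classical
  let _ : DirectSum.Decomposition 𝒱 := h.chooseDecomposition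
  refine ⟨fun i => (𝒱 i).subtype ∘ₗ DirectSum.component K ℕ (fun i => 𝒱 i) i ∘ₗ
    (DirectSum.decomposeLinearEquiv 𝒱).toLinearMap, ?_, ?_, ?_, h.submodule_iSup_eq_top⟩
  · intro i v
    exact Subtype.property _
  · intro i v hv
    exact DirectSum.decompose_of_mem_same 𝒱 hv
  · intro i j v hv hij
    exact DirectSum.decompose_of_mem_ne 𝒱 hv hij.symm

/-- The operator acting on the degree `i` piece as multiplication by `2 * i - c`. -/
def weightOp (π : ℕ → Module.End K V) (c : ℕ) : Module.End K V :=
  ∑ i ∈ Finset.range (c + 1), (2 * (i : K) - c) • π i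

namespace IsGradProj

variable {𝒱 : ℕ → Submodule K V} {π : ℕ → Module.End K V}

theorem induction (P : IsGradProj 𝒱 π) {motive : V → Prop} (v : V)
    (hom : ∀ i, ∀ v ∈ 𝒱 i, motive v) (add : ∀ v w, motive v → motive w → motive (v + w)) :
    motive v := by
  have hv : v ∈ ⨆ i, 𝒱 i := by rw [P.top]; trivial
  exact Submodule.iSup_induction 𝒱 (motive := motive) hv hom (hom 0 0 (zero_mem _)) add

theorem ext {W : Type*} [AddCommGroup W] [Module K W] (P : IsGradProj 𝒱 π) {a b : V →ₗ[K] W}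
    (h : ∀ i, ∀ v ∈ 𝒱 i, a v = b v) : a = b := by
  ext v
  exact P.induction v h fun v w hv hw => by rw [map_add, map_add, hv, hw]

theorem mul_self (P : IsGradProj 𝒱 π) (i : ℕ) : π i * π i = π i := by
  ext v
  exact P.same i _ (P.mem i v)

theorem mul_ne (P : IsGradProj 𝒱 π) {i j : ℕ} (hij : i ≠ j) : π i * π j = 0 := by
  ext v
  exact P.ne i j _ (P.mem j v) hij

theorem sum_eq_one (P : IsGradProj 𝒱 π) {c : ℕ} (hc : ∀ i, c < i → 𝒱 i = ⊥) :
    ∑ i ∈ Finset.range (c + 1), π i = 1 := by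
  apply P.ext
  intro j v hv
  by_cases hj : j ≤ c
  · rw [LinearMap.sum_apply, Finset.sum_eq_single j]
    · simpa using P.same j v hv
    · intro i _ hij
      exact P.ne i j v hv hij
    · intro h
      exact absurd (Finset.mem_range.2 (by omega)) h
  · rw [hc j (by omega), Submodule.mem_bot] at hv
    simp [hv]

theorem weightOp_apply (P : IsGradProj 𝒱 π) {c : ℕ} (hc : ∀ i, c < i → 𝒱 i = ⊥) {i : ℕ} {v : V}
    (hv : v ∈ 𝒱 i) : weightOp π c v = (2 * (i : K) - c) • v := by
  by_cases hi : i ≤ c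
  · rw [weightOp, LinearMap.sum_apply, Finset.sum_eq_single i]
    · rw [LinearMap.smul_apply, P.same i v hv]
    · intro j _ hij
      rw [LinearMap.smul_apply, P.ne j i v hv hij, smul_zero]
    · intro h
      exact absurd (Finset.mem_range.2 (by omega)) h
  · rw [hc i (by omega), Submodule.mem_bot] at hv
    simp [hv]

theorem proj_succ_comm (P : IsGradProj 𝒱 π) {e : Module.End K V}
    (he : ∀ i, ∀ v ∈ 𝒱 i, e v ∈ 𝒱 (i + 1)) (i : ℕ) (v : V) : π (i + 1) (e v) = e (π i v) := by
  induction v using P.induction with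
  | hom j v hv =>
    by_cases hij : i = j
    · subst hij
      rw [P.same _ _ hv, P.same _ _ (he _ _ hv)]
    · rw [P.ne _ _ _ hv hij, P.ne _ _ _ (he _ _ hv) (by omega), map_zero]
  | add v w hv hw => simp only [map_add, hv, hw]

theorem proj_zero_comm (P : IsGradProj 𝒱 π) {e : Module.End K V}
    (he : ∀ i, ∀ v ∈ 𝒱 i, e v ∈ 𝒱 (i + 1)) (v : V) : π 0 (e v) = 0 := by
  induction v using P.induction with
  | hom j v hv => exact P.ne _ _ _ (he _ _ hv) (by omega)
  | add v w hv hw => simp only [map_add, hv, hw, add_zero]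

theorem pow_mem {e : Module.End K V} (he : ∀ i, ∀ v ∈ 𝒱 i, e v ∈ 𝒱 (i + 1)) (n : ℕ) {i : ℕ}
    {v : V} (hv : v ∈ 𝒱 i) : (e ^ n) v ∈ 𝒱 (i + n) := by
  induction n with
  | zero => simpa using hv
  | succ n ih =>
    rw [pow_succ', Module.End.mul_apply]
    exact he _ _ ih

/-- An endomorphism commuting with a strong Lefschetz operator has the same trace on opposite
degrees. -/
theorem trace_symm (P : IsGradProj 𝒱 π) {c : ℕ}
    {e : Module.End K V} (he : ∀ i, ∀ v ∈ 𝒱 i, e v ∈ 𝒱 (i + 1))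
    (hSL : ∀ i : ℕ, 2 * i ≤ c → (∀ v ∈ 𝒱 i, (e ^ (c - 2 * i)) v = 0 → v = 0) ∧
      (∀ w ∈ 𝒱 (c - i), ∃ v ∈ 𝒱 i, (e ^ (c - 2 * i)) v = w))
    {y : Module.End K V} (hy : e * y = y * e) {i : ℕ} (hi : 2 * i ≤ c) :
    LinearMap.trace K V (π (c - i) * y) = LinearMap.trace K V (π i * y) := by
  obtain ⟨n, hn⟩ : ∃ n, n = c - 2 * i := ⟨_, rfl⟩
  obtain ⟨hinj, hsurj⟩ := hSL i hi
  rw [← hn] at hinj hsurj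
  have hmem : ∀ v ∈ 𝒱 i, (e ^ n) v ∈ 𝒱 (c - i) := by
    intro v hv
    have := pow_mem he n hv
    rwa [show i + n = c - i by omega] at this
  let E : 𝒱 i ≃ₗ[K] 𝒱 (c - i) := LinearEquiv.ofBijective ((e ^ n).restrict hmem) <| by
    constructor
    · rw [injective_iff_map_eq_zero]
      rintro ⟨v, hv⟩ h0
      exact Subtype.ext (hinj v hv (congrArg Subtype.val h0))
    · rintro ⟨w, hw⟩
      obtain ⟨v, hv, hvw⟩ := hsurj w hw
      exact ⟨⟨v, hv⟩, Subtype.ext hvw⟩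
  let u : Module.End K V := (𝒱 i).subtype ∘ₗ E.symm.toLinearMap ∘ₗ
    (π (c - i)).codRestrict (𝒱 (c - i)) (P.mem _)
  have h1 : e ^ n * u = π (c - i) := by
    ext v
    exact congrArg Subtype.val (E.apply_symm_apply ⟨π (c - i) v, P.mem _ v⟩)
  have h2 : u * e ^ n = π i := by
    apply P.ext
    intro j v hv
    by_cases hij : i = j
    · subst hij
      have : (π (c - i)).codRestrict (𝒱 (c - i)) (P.mem _) ((e ^ n) v) = E ⟨v, hv⟩ :=
        Subtype.ext (P.same _ _ (hmem v hv))
      rw [P.same _ _ hv, Module.End.mul_apply]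
      simp only [u, LinearMap.comp_apply, this, LinearEquiv.coe_coe, E.symm_apply_apply]
      rfl
    · have : (π (c - i)).codRestrict (𝒱 (c - i)) (P.mem _) ((e ^ n) v) = 0 :=
        Subtype.ext (P.ne _ _ _ (pow_mem he n hv) (by omega))
      rw [P.ne _ _ _ hv hij, Module.End.mul_apply]
      simp only [u, LinearMap.comp_apply, this, map_zero]
  have h3 : e ^ n * y = y * e ^ n := (show Commute e y from hy).pow_left n
  rw [← h1, mul_assoc, LinearMap.trace_mul_comm, mul_assoc, ← h3, ← mul_assoc, h2]

variable [FiniteDimensional K V] [CharZero K]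

/-- A strong Lefschetz operator is the raising operator of an `sl₂`-triple. -/
theorem exists_isSlTwo (P : IsGradProj 𝒱 π) {c : ℕ} (hc : ∀ i, c < i → 𝒱 i = ⊥)
    {e : Module.End K V} (he : ∀ i, ∀ v ∈ 𝒱 i, e v ∈ 𝒱 (i + 1))
    (hSL : ∀ i : ℕ, 2 * i ≤ c → (∀ v ∈ 𝒱 i, (e ^ (c - 2 * i)) v = 0 → v = 0) ∧
      (∀ w ∈ 𝒱 (c - i), ∃ v ∈ 𝒱 i, (e ^ (c - 2 * i)) v = w)) :
    ∃ f, IsSlTwo e f (weightOp π c) := by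
  have htr : ∀ y : Module.End K V, e * y = y * e →
      LinearMap.trace K V (weightOp π c * y) = 0 := by
    intro y hy
    have hsym : ∀ i ≤ c, LinearMap.trace K V (π (c - i) * y) = LinearMap.trace K V (π i * y) := by
      intro i hi
      by_cases h : 2 * i ≤ c
      · exact P.trace_symm he hSL hy h
      · have := P.trace_symm he hSL hy (i := c - i) (by omega)
        rw [Nat.sub_sub_self hi] at this
        exact this.symm
    have hS : LinearMap.trace K V (weightOp π c * y) = ∑ i ∈ Finset.range (c + 1),
        (2 * (i : K) - c) * LinearMap.trace K V (π i * y) := by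
      simp [weightOp, Finset.sum_mul, map_sum]
    have hneg : LinearMap.trace K V (weightOp π c * y) =
        -LinearMap.trace K V (weightOp π c * y) := by
      conv_lhs => rw [hS, ← Finset.sum_range_reflect]
      rw [hS, ← Finset.sum_neg_distrib]
      apply Finset.sum_congr rfl
      intro i hi
      have hi' : i ≤ c := by have := Finset.mem_range.1 hi; omega
      rw [show c + 1 - 1 - i = c - i by omega, hsym i hi', Nat.cast_sub hi']
      ring
    exact self_eq_neg.1 hneg
  obtain ⟨f₀, hf₀⟩ := exists_commutator_eq e (weightOp π c) htr
  have hf₀' : ∀ v, e (f₀ v) - f₀ (e v) = weightOp π c v := fun v => by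
    rw [← hf₀]; rfl
  have hw : ∀ {i v}, v ∈ 𝒱 i → weightOp π c v = (2 * (i : K) - c) • v := P.weightOp_apply hc
  let f : Module.End K V := ∑ i ∈ Finset.range (c + 1), π i * f₀ * π (i + 1)
  have fz : ∀ v ∈ 𝒱 0, f v = 0 := by
    intro v hv
    simp only [f, LinearMap.sum_apply, Module.End.mul_apply]
    refine Finset.sum_eq_zero fun i _ => ?_
    rw [P.ne _ _ v hv (by omega), map_zero, map_zero]
  have fs : ∀ j, ∀ v ∈ 𝒱 (j + 1), f v = π j (f₀ v) := by
    intro j v hv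
    by_cases hj : j ≤ c
    · simp only [f, LinearMap.sum_apply, Module.End.mul_apply]
      rw [Finset.sum_eq_single j]
      · rw [P.same _ _ hv]
      · intro i _ hij
        rw [P.ne _ _ v hv (by omega), map_zero, map_zero]
      · intro h
        exact absurd (Finset.mem_range.2 (by omega)) h
    · rw [hc _ (by omega), Submodule.mem_bot] at hv
      simp [hv]
  refine ⟨f, ?_, ?_, ?_⟩
  · apply P.ext
    rintro (_ | j) v hv
    · have h1 := fs 0 (e v) (he 0 v hv)
      have h2 := congrArg (π 0) (hf₀' v)
      rw [map_sub, P.proj_zero_comm he, ← h1, P.same 0 (weightOp π c v)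
        (by rw [hw hv]; exact Submodule.smul_mem _ _ hv)] at h2
      simp only [LinearMap.sub_apply, Module.End.mul_apply, fz v hv, map_zero, h2]
    · have h1 := fs (j + 1) (e v) (he _ v hv)
      have h2 := congrArg (π (j + 1)) (hf₀' v)
      rw [map_sub, P.proj_succ_comm he, P.same (j + 1) (weightOp π c v)
        (by rw [hw hv]; exact Submodule.smul_mem _ _ hv), ← h1, ← fs j v hv] at h2
      exact h2
  · apply P.ext
    intro j v hv
    simp only [LinearMap.sub_apply, Module.End.mul_apply, LinearMap.smul_apply, hw hv,
      hw (he j v hv), map_smul]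
    push_cast
    module
  · apply P.ext
    rintro (_ | j) v hv
    · simp [fz v hv, hw hv]
    · have hm : f v ∈ 𝒱 j := by rw [fs j v hv]; exact P.mem _ _
      simp only [LinearMap.sub_apply, Module.End.mul_apply, LinearMap.smul_apply,
        LinearMap.neg_apply, hw hv, hw hm, map_smul]
      push_cast
      module

end IsGradProj

end Grading

section Deformation

variable {K U : Type*} [Field K] [AddCommGroup U] [Module K U] [FiniteDimensional K U]

/-- Injectivity on `ker h` of the `n`-th power of a polynomial family of endomorphisms is a
Zariski open condition. -/
theorem finite_setOf_exists_ker {α : Type*} (s : Finset α) (d : α → ℕ) (c₀ : Module.End K U)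
    (c : α → Module.End K U) (h : Module.End K U) (n : ℕ)
    (H : ∀ v, h v = 0 → ((c₀ + ∑ a ∈ s, (0 : K) ^ d a • c a) ^ n) v = 0 → v = 0) :
    {t : K | ∃ v, v ≠ 0 ∧ h v = 0 ∧ ((c₀ + ∑ a ∈ s, t ^ d a • c a) ^ n) v = 0}.Finite := by
  classical
  let L : K → Module.End K U := fun t => c₀ + ∑ a ∈ s, t ^ d a • c a
  let T : U →ₗ[K] U × U := (L 0 ^ n).prod h
  have hT : LinearMap.ker T = ⊥ := by
    rw [LinearMap.ker_eq_bot']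
    intro v hv
    exact H v (congrArg Prod.snd hv) (congrArg Prod.fst hv)
  obtain ⟨R, hR⟩ := T.exists_leftInverse_of_injective hT
  let R₁ : Module.End K U := R ∘ₗ LinearMap.inl K U U
  let R₂ : Module.End K U := R ∘ₗ LinearMap.inr K U U
  have hR' : R₁ * L 0 ^ n + R₂ * h = 1 := by
    rw [Module.End.one_eq_id, ← hR]
    ext v
    simp only [LinearMap.add_apply, Module.End.mul_apply, R₁, R₂, LinearMap.comp_apply, ← map_add,
      T, LinearMap.prod_apply]
    congr 1
    simp
  let b := Module.finBasis K U
  let m : Module.End K U → Matrix _ _ (Polynomial K) :=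
    fun x => (LinearMap.toMatrix b b x).map Polynomial.C
  let M := m c₀ + ∑ a ∈ s, (Polynomial.X ^ d a : Polynomial K) • m (c a)
  let p : Polynomial K := (m R₁ * M ^ n + m (R₂ * h)).det
  have hm : ∀ t x, (Polynomial.evalRingHom t).mapMatrix (m x) = LinearMap.toMatrix b b x := by
    intro t x
    ext i j
    simp [m]
  have hM : ∀ t, (Polynomial.evalRingHom t).mapMatrix M = LinearMap.toMatrix b b (L t) := by
    intro t
    simp only [M, L, map_add, map_sum, hm, map_smul]
    congr 1
    refine Finset.sum_congr rfl fun a _ => ?_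
    rw [← hm t (c a)]
    ext i j
    simp
  have hp : ∀ t, p.eval t = LinearMap.det (R₁ * L t ^ n + R₂ * h) := by
    intro t
    rw [← LinearMap.det_toMatrix b, ← Polynomial.coe_evalRingHom, RingHom.map_det]
    congr 1
    rw [map_add, map_mul, map_pow, hm, hM, hm, LinearMap.toMatrix_pow,
      ← LinearMap.toMatrix_mul, ← map_add]
  have hp0 : p ≠ 0 := by
    intro h0
    have := hp 0
    rw [hR', h0] at this
    simp at this
  refine (Polynomial.finite_setOfPred_isRoot hp0).subset ?_
  rintro t ⟨v, hv, h1, h2⟩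
  by_contra hroot
  have hdet : LinearMap.det (R₁ * L t ^ n + R₂ * h) ≠ 0 := by rw [← hp]; exact hroot
  apply hv
  apply (LinearMap.equivOfDetNeZero _ hdet).injective
  rw [map_zero]
  change R₁ ((L t ^ n) v) + R₂ (h v) = 0
  rw [h1, show (L t ^ n) v = 0 from h2, map_zero, map_zero, add_zero]

/-- Let `P` be a grading of `U` for which `Z` has degree one, `S` has degree zero and `N` is a sum
of terms of positive degree. If `(Z + S) ^ n` is injective on an eigenspace of `h`, then so is
`(Z + t • (S + N)) ^ n` for all but finitely many `t`. -/
theorem finite_setOf_deformation {P : ℕ → Module.End K U} {r : ℕ}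
    (hsum : ∑ p ∈ Finset.range r, P p = 1) (hsame : ∀ p, P p * P p = P p)
    (hne : ∀ p q, p ≠ q → P p * P q = 0) {Z S N h : Module.End K U}
    (hZ : ∀ p, P (p + 1) * Z = Z * P p) (hZ0 : P 0 * Z = 0) (hS : ∀ p, P p * S = S * P p)
    (hN : ∀ p q, q ≤ p → P q * N * P p = 0)
    (hh : ∀ p, P p * h = h * P p) (n : ℕ) (H : ∀ v, h v = 0 → ((Z + S) ^ n) v = 0 → v = 0) :
    {t : K | t ≠ 0 ∧ ∃ v, v ≠ 0 ∧ h v = 0 ∧ ((Z + t • (S + N)) ^ n) v = 0}.Finite := by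
  have hPr : P r = 0 := by
    rw [← mul_one (P r), ← hsum, Finset.mul_sum]
    exact Finset.sum_eq_zero fun p hp => hne _ _ (Finset.mem_range.1 hp).ne'
  let s := Finset.range r ×ˢ Finset.range r
  refine (finite_setOf_exists_ker s (fun a => a.1 - a.2) (Z + S) (fun a => P a.1 * N * P a.2) h n
    ?_).subset ?_
  · have : ∑ a ∈ s, (0 : K) ^ (a.1 - a.2) • (P a.1 * N * P a.2) = 0 := by
      refine Finset.sum_eq_zero fun a _ => ?_
      by_cases ha : a.1 ≤ a.2
      · rw [hN _ _ ha, smul_zero]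
      · rw [zero_pow (by omega), zero_smul]
    rw [this, add_zero]
    exact H
  rintro t ⟨ht, v, hv, h1, h2⟩
  obtain ⟨τ, hτ⟩ : ∃ τ : Module.End K U, τ = ∑ p ∈ Finset.range r, t ^ p • P p := ⟨_, rfl⟩
  have hPτ : ∀ q ∈ Finset.range r, P q * τ = t ^ q • P q := by
    intro q hq
    rw [hτ, Finset.mul_sum, Finset.sum_eq_single q]
    · rw [mul_smul_comm, hsame]
    · intro p _ hpq
      rw [mul_smul_comm, hne _ _ hpq.symm, smul_zero]
    · intro h
      exact absurd hq h
  have hτZ : τ * Z = t • (Z * τ) := by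
    have h3 : τ = ∑ p ∈ Finset.range (r + 1), t ^ p • P p := by
      rw [Finset.sum_range_succ, hPr, smul_zero, add_zero, hτ]
    conv_lhs => rw [h3]
    rw [Finset.sum_range_succ', add_mul, smul_mul_assoc, hZ0, smul_zero, add_zero, hτ,
      Finset.mul_sum, Finset.sum_mul, Finset.smul_sum]
    refine Finset.sum_congr rfl fun p _ => ?_
    rw [smul_mul_assoc, hZ, mul_smul_comm, smul_smul, pow_succ']
  have hτS : τ * S = S * τ := by
    rw [hτ, Finset.mul_sum, Finset.sum_mul]
    refine Finset.sum_congr rfl fun p _ => ?_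
    rw [smul_mul_assoc, hS, mul_smul_comm]
  have hτh : τ * h = h * τ := by
    rw [hτ, Finset.mul_sum, Finset.sum_mul]
    refine Finset.sum_congr rfl fun p _ => ?_
    rw [smul_mul_assoc, hh, mul_smul_comm]
  have hτN : τ * N = (∑ a ∈ s, t ^ (a.1 - a.2) • (P a.1 * N * P a.2)) * τ := by
    conv_lhs => rw [← mul_one N, ← hsum, hτ, Finset.mul_sum _ _ N]
    rw [Finset.sum_mul_sum, ← Finset.sum_product', Finset.sum_mul]
    refine Finset.sum_congr rfl fun a ha => ?_
    rw [smul_mul_assoc, smul_mul_assoc, mul_assoc _ (P a.2) τ,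
      hPτ _ (Finset.mem_product.1 ha).2, mul_smul_comm, smul_smul, ← mul_assoc]
    by_cases hle : a.1 ≤ a.2
    · rw [hN _ _ hle, smul_zero, smul_zero]
    · rw [← pow_add, Nat.sub_add_cancel (by omega)]
  have hsemi : SemiconjBy τ (Z + t • (S + N))
      (t • (Z + S + ∑ a ∈ s, t ^ (a.1 - a.2) • (P a.1 * N * P a.2))) := by
    rw [SemiconjBy, mul_add, mul_smul_comm, mul_add, hτZ, hτS, hτN, smul_mul_assoc, add_mul,
      add_mul, smul_add, smul_add, smul_add, add_assoc]
  refine ⟨τ v, ?_, ?_, ?_⟩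
  · intro h0
    apply hv
    have : v = ∑ p ∈ Finset.range r, P p v := by
      rw [← LinearMap.sum_apply, hsum, Module.End.one_apply]
    rw [this]
    refine Finset.sum_eq_zero fun q hq => ?_
    have h3 := congrArg (fun x : Module.End K U => x v) (hPτ q hq)
    simp only [Module.End.mul_apply, h0, map_zero, LinearMap.smul_apply] at h3
    exact (smul_eq_zero.1 h3.symm).resolve_left (pow_ne_zero _ ht)
  · rw [← Module.End.mul_apply, ← hτh, Module.End.mul_apply, h1, map_zero]
  · have h3 := congrArg (fun x : Module.End K U => x v) (hsemi.pow_right n).eq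
    simp only [Module.End.mul_apply, h2, map_zero, smul_pow, LinearMap.smul_apply] at h3
    exact (smul_eq_zero.1 h3.symm).resolve_left (pow_ne_zero _ ht)

end Deformation

section TensorTriple

variable {K V W : Type*} [Field K] [AddCommGroup V] [Module K V] [AddCommGroup W] [Module K W]

theorem IsSlTwo.tensor {e f h : Module.End K V} {e' f' h' : Module.End K W} (t : IsSlTwo e f h)
    (t' : IsSlTwo e' f' h') : IsSlTwo (e.rTensor W + e'.lTensor V) (f.rTensor W + f'.lTensor V)
      (h.rTensor W + h'.lTensor V) where
  ef := by
    ext v w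
    simp only [TensorProduct.AlgebraTensorModule.curry_apply, LinearMap.restrictScalars_self,
      TensorProduct.curry_apply, LinearMap.sub_apply, Module.End.mul_apply, LinearMap.add_apply,
      LinearMap.rTensor_tmul, LinearMap.lTensor_tmul, map_add, t.e_f, t'.e_f, add_tmul, tmul_add]
    abel
  he := by
    ext v w
    simp only [TensorProduct.AlgebraTensorModule.curry_apply, LinearMap.restrictScalars_self,
      TensorProduct.curry_apply, LinearMap.sub_apply, Module.End.mul_apply, LinearMap.add_apply,
      LinearMap.rTensor_tmul, LinearMap.lTensor_tmul, map_add, t.h_e, t'.h_e, add_tmul, tmul_add,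
      LinearMap.smul_apply, tmul_smul, ← smul_tmul', smul_add]
    abel
  hf := by
    ext v w
    simp only [TensorProduct.AlgebraTensorModule.curry_apply, LinearMap.restrictScalars_self,
      TensorProduct.curry_apply, LinearMap.sub_apply, Module.End.mul_apply, LinearMap.add_apply,
      LinearMap.rTensor_tmul, LinearMap.lTensor_tmul, map_add, t.h_f, t'.h_f, sub_tmul, tmul_sub,
      LinearMap.smul_apply, LinearMap.neg_apply, tmul_smul, ← smul_tmul', smul_add]
    abel

end TensorTriple

section GradingMore

variable {K V : Type*} [Field K] [AddCommGroup V] [Module K V] {𝒱 : ℕ → Submodule K V}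
  {π : ℕ → Module.End K V}

theorem IsGradProj.proj_weightOp (P : IsGradProj 𝒱 π) {c : ℕ} (hc : ∀ i, c < i → 𝒱 i = ⊥) (j : ℕ)
    (v : V) : π j (weightOp π c v) = weightOp π c (π j v) := by
  induction v using P.induction with
  | hom i v hv =>
    rw [P.weightOp_apply hc hv, map_smul]
    by_cases hij : j = i
    · subst hij
      rw [P.same _ _ hv, P.weightOp_apply hc hv]
    · rw [P.ne _ _ _ hv hij, map_zero, smul_zero]
  | add v w hv hw => simp only [map_add, hv, hw]

theorem IsGradProj.mem_of_weightOp [CharZero K] (P : IsGradProj 𝒱 π) {c : ℕ}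
    (hc : ∀ i, c < i → 𝒱 i = ⊥) {i : ℕ} {v : V} (hv : weightOp π c v = (2 * (i : K) - c) • v) :
    v ∈ 𝒱 i := by
  have h1 : v = ∑ j ∈ Finset.range (c + 1), π j v := by
    rw [← LinearMap.sum_apply, P.sum_eq_one hc, Module.End.one_apply]
  rw [h1]
  refine Submodule.sum_mem _ fun j _ => ?_
  by_cases hij : j = i
  · subst hij; exact P.mem _ _
  · have h2 := P.proj_weightOp hc j v
    rw [hv, map_smul, P.weightOp_apply hc (P.mem j v), ← sub_eq_zero, ← sub_smul] at h2
    have h3 : (2 * (i : K) - c - (2 * (j : K) - c)) ≠ 0 := by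
      intro h4
      have h5 : (2 : K) * ((i : K) - j) = 0 := by linear_combination h4
      have h6 := (mul_eq_zero.1 h5).resolve_left two_ne_zero
      exact hij (Nat.cast_injective (sub_eq_zero.1 h6)).symm
    rw [(smul_eq_zero.1 h2).resolve_left h3]
    exact zero_mem _

end GradingMore

section FiberStructure

variable {K B A : Type} [Field K] [CommRing B] [Algebra K B] [CommRing A] [Algebra K A]
  {ℬ : ℕ → Submodule K B} {𝒜 : ℕ → Submodule K A} {φ : B →ₐ[K] A}

theorem fiberIdeal_induction {motive : A → Prop} {r : A} (hr : r ∈ fiberIdeal K ℬ φ)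
    (mul : ∀ p, 1 ≤ p → ∀ b ∈ ℬ p, ∀ a, motive (φ b * a))
    (add : ∀ x y, motive x → motive y → motive (x + y)) : motive r := by
  have h0 : motive 0 := by simpa using mul 1 le_rfl 0 (zero_mem _) 0
  suffices h : ∀ a, motive (a * r) by simpa using h 1
  refine Submodule.span_induction (p := fun r _ => ∀ a, motive (a * r)) ?_ ?_ ?_ ?_ hr
  · intro x hx a
    simp only [Set.mem_iUnion, Set.mem_image] at hx
    obtain ⟨p, hp, b, hb, rfl⟩ := hx
    rw [mul_comm]
    exact mul p hp b hb a
  · intro a; simpa using h0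
  · intro x y _ _ hx hy a
    rw [mul_add]
    exact add _ _ (hx a) (hy a)
  · intro a' x _ hx a
    rw [smul_eq_mul, ← mul_assoc]
    exact hx _

theorem map_mem_fiberIdeal {p : ℕ} (hp : 1 ≤ p) {b : B} (hb : b ∈ ℬ p) :
    φ b ∈ fiberIdeal K ℬ φ :=
  Ideal.subset_span (Set.mem_biUnion hp ⟨b, hb, rfl⟩)

variable {πA : ℕ → Module.End K A}

theorem proj_mem_fiberIdeal (hAmul : ∀ i j : ℕ, ∀ x ∈ 𝒜 i, ∀ y ∈ 𝒜 j, x * y ∈ 𝒜 (i + j))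
    (hgr : ∀ i : ℕ, ∀ x ∈ ℬ i, φ x ∈ 𝒜 i) (PA : IsGradProj 𝒜 πA) (i : ℕ) {r : A}
    (hr : r ∈ fiberIdeal K ℬ φ) : πA i r ∈ fiberIdeal K ℬ φ := by
  refine fiberIdeal_induction (motive := fun r => πA i r ∈ fiberIdeal K ℬ φ) hr ?_ ?_
  · intro p hp b hb a
    induction a using PA.induction with
    | hom q a ha =>
      have hmem := hAmul p q _ (hgr p b hb) a ha
      by_cases hi : i = p + q
      · subst hi
        rw [PA.same _ _ hmem]
        exact Ideal.mul_mem_right _ _ (map_mem_fiberIdeal hp hb)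
      · rw [PA.ne _ _ _ hmem hi]
        exact zero_mem _
    | add x y hx hy =>
      rw [mul_add, map_add]
      exact add_mem hx hy
  · intro x y hx hy
    rw [map_add]
    exact add_mem hx hy

theorem exists_fiber_isGradProj
    (hAmul : ∀ i j : ℕ, ∀ x ∈ 𝒜 i, ∀ y ∈ 𝒜 j, x * y ∈ 𝒜 (i + j))
    (hgr : ∀ i : ℕ, ∀ x ∈ ℬ i, φ x ∈ 𝒜 i) (PA : IsGradProj 𝒜 πA) :
    ∃ πF, IsGradProj (fiberGrading K ℬ φ 𝒜) πF ∧ ∀ i a,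
      πF i (Ideal.Quotient.mkₐ K (fiberIdeal K ℬ φ) a) =
        Ideal.Quotient.mkₐ K (fiberIdeal K ℬ φ) (πA i a) := by
  set mk := Ideal.Quotient.mkₐ K (fiberIdeal K ℬ φ) with hmk
  have hsurj : Function.Surjective mk := Ideal.Quotient.mkₐ_surjective K _
  obtain ⟨s, hs⟩ :=
    mk.toLinearMap.exists_rightInverse_of_surjective (LinearMap.range_eq_top.2 hsurj)
  have hs' : ∀ x, mk (s x) = x := fun x => congrArg (fun f => f x) hs
  have key : ∀ i a, mk (πA i (s (mk a))) = mk (πA i a) := by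
    intro i a
    refine Ideal.Quotient.eq.2 ?_
    rw [← map_sub]
    apply proj_mem_fiberIdeal hAmul hgr PA
    exact Ideal.Quotient.eq.1 (hs' (mk a))
  refine ⟨fun i => mk.toLinearMap ∘ₗ πA i ∘ₗ s, ⟨?_, ?_, ?_, ?_⟩, key⟩
  · intro i x
    exact ⟨_, PA.mem i _, rfl⟩
  · rintro i _ ⟨a, ha, rfl⟩
    refine (key i a).trans ?_
    rw [PA.same i a ha]; rfl
  · rintro i j _ ⟨a, ha, rfl⟩ hij
    refine (key i a).trans ?_
    rw [PA.ne i j a ha hij, map_zero]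
  · have : (⨆ i, fiberGrading K ℬ φ 𝒜 i) = Submodule.map mk.toLinearMap (⨆ i, 𝒜 i) :=
      (Submodule.map_iSup _ _).symm
    rw [this, PA.top, Submodule.map_top, LinearMap.range_eq_top]
    exact hsurj

theorem exists_graded_section {πF : ℕ → Module.End K (A ⧸ fiberIdeal K ℬ φ)}
    (PA : IsGradProj 𝒜 πA) (PF : IsGradProj (fiberGrading K ℬ φ 𝒜) πF)
    (hπ : ∀ i a, πF i (Ideal.Quotient.mkₐ K (fiberIdeal K ℬ φ) a) =
        Ideal.Quotient.mkₐ K (fiberIdeal K ℬ φ) (πA i a)) {c : ℕ}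
    (hc : ∀ i, c < i → fiberGrading K ℬ φ 𝒜 i = ⊥) :
    ∃ s : A ⧸ fiberIdeal K ℬ φ →ₗ[K] A,
      (∀ x, Ideal.Quotient.mkₐ K (fiberIdeal K ℬ φ) (s x) = x) ∧
      ∀ i, ∀ x ∈ fiberGrading K ℬ φ 𝒜 i, s x ∈ 𝒜 i := by
  set mk := Ideal.Quotient.mkₐ K (fiberIdeal K ℬ φ) with hmk
  have hsurj : Function.Surjective mk := Ideal.Quotient.mkₐ_surjective K _
  obtain ⟨s, hs⟩ :=
    mk.toLinearMap.exists_rightInverse_of_surjective (LinearMap.range_eq_top.2 hsurj)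
  have hs' : ∀ x, mk (s x) = x := fun x => congrArg (fun f => f x) hs
  refine ⟨∑ i ∈ Finset.range (c + 1), πA i ∘ₗ s ∘ₗ πF i, ?_, ?_⟩
  · intro x
    rw [LinearMap.sum_apply, map_sum]
    have h1 : ∑ i ∈ Finset.range (c + 1), πF i x = x := by
      rw [← LinearMap.sum_apply, PF.sum_eq_one hc, Module.End.one_apply]
    conv_rhs => rw [← h1]
    refine Finset.sum_congr rfl fun i _ => ?_
    rw [LinearMap.comp_apply, LinearMap.comp_apply, ← hπ, hs']
    exact PF.same i _ (PF.mem i x)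
  · intro i x hx
    rw [LinearMap.sum_apply]
    refine Submodule.sum_mem _ fun j _ => ?_
    rw [LinearMap.comp_apply, LinearMap.comp_apply]
    by_cases hij : j = i
    · subst hij; exact PA.mem _ _
    · rw [PF.ne _ _ _ hx hij, map_zero, map_zero]
      exact zero_mem _

/-- The `B`-linear extension of a section of the projection to the fiber. -/
noncomputable def extendSection (φ : B →ₐ[K] A) (s : A ⧸ fiberIdeal K ℬ φ →ₗ[K] A) :
    B ⊗[K] (A ⧸ fiberIdeal K ℬ φ) →ₗ[K] A :=
  TensorProduct.lift ((LinearMap.mul K A).compl₁₂ φ.toLinearMap s)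

theorem extendSection_tmul (s : A ⧸ fiberIdeal K ℬ φ →ₗ[K] A) (b : B)
    (x : A ⧸ fiberIdeal K ℬ φ) : extendSection φ s (b ⊗ₜ x) = φ b * s x := rfl

theorem extendSection_rTensor (s : A ⧸ fiberIdeal K ℬ φ →ₗ[K] A) (b : B)
    (u : B ⊗[K] (A ⧸ fiberIdeal K ℬ φ)) :
    extendSection φ s ((LinearMap.mulLeft K b).rTensor _ u) = φ b * extendSection φ s u := by
  induction u with
  | zero => simp
  | tmul b' x => simp [extendSection_tmul, mul_assoc]
  | add u v hu hv => rw [map_add, map_add, hu, hv, map_add, mul_add]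

theorem extendSection_surjective (hBone : (1 : B) ∈ ℬ 0)
    (hBmul : ∀ i j : ℕ, ∀ x ∈ ℬ i, ∀ y ∈ ℬ j, x * y ∈ ℬ (i + j)) {b : ℕ}
    (hb : ∀ i, b < i → ℬ i = ⊥) {s : A ⧸ fiberIdeal K ℬ φ →ₗ[K] A}
    (hs : ∀ x, Ideal.Quotient.mkₐ K (fiberIdeal K ℬ φ) (s x) = x) :
    Function.Surjective (extendSection φ s) := by
  have key : ∀ d p : ℕ, b + 1 ≤ p + d → ∀ β ∈ ℬ p, ∀ a,
      φ β * a ∈ LinearMap.range (extendSection φ s) := by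
    intro d
    induction d with
    | zero =>
      intro p hp β hβ a
      rw [hb p (by omega), Submodule.mem_bot] at hβ
      simp [hβ]
    | succ d ih =>
      intro p hp β hβ a
      obtain ⟨r, hr⟩ : ∃ r, r = a - s (Ideal.Quotient.mkₐ K (fiberIdeal K ℬ φ) a) := ⟨_, rfl⟩
      have hrI : r ∈ fiberIdeal K ℬ φ := by
        rw [hr]
        exact Ideal.Quotient.eq.1 (hs _).symm
      have h1 : φ β * r ∈ LinearMap.range (extendSection φ s) := by
        refine fiberIdeal_induction
          (motive := fun r => φ β * r ∈ LinearMap.range (extendSection φ s)) hrI ?_ ?_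
        · intro p' hp' b' hb' a'
          rw [← mul_assoc, ← map_mul]
          exact ih (p + p') (by omega) _ (hBmul _ _ _ hβ _ hb') _
        · intro x y hx hy
          rw [mul_add]
          exact add_mem hx hy
      have h2 : φ β * a = φ β * r + extendSection φ s
          (β ⊗ₜ Ideal.Quotient.mkₐ K (fiberIdeal K ℬ φ) a) := by
        rw [extendSection_tmul, hr]; ring
      rw [h2]
      exact add_mem h1 ⟨_, rfl⟩
  intro a
  have := key (b + 1) 0 (by omega) 1 hBone a
  rwa [map_one, one_mul] at this

theorem finrank_fiber_le {πB : ℕ → Module.End K B} (PB : IsGradProj ℬ πB)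
    (hB0 : ℬ 0 = Submodule.span K {(1 : B)}) {k : ℕ} {e : Fin k → A}
    (he : ∀ x : A, ∃ v : Fin k → B, x = ∑ j, φ (v j) * e j) :
    Module.finrank K (A ⧸ fiberIdeal K ℬ φ) ≤ k := by
  set mk := Ideal.Quotient.mkₐ K (fiberIdeal K ℬ φ) with hmk
  have hsc : ∀ b : B, ∃ κ : K, mk (φ b) = κ • 1 := by
    intro b
    induction b using PB.induction with
    | hom p b hb =>
      rcases Nat.eq_zero_or_pos p with rfl | hp
      · rw [hB0, Submodule.mem_span_singleton] at hb
        obtain ⟨κ, rfl⟩ := hb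
        exact ⟨κ, by simp⟩
      · refine ⟨0, ?_⟩
        rw [zero_smul]
        exact Ideal.Quotient.eq_zero_iff_mem.2 (map_mem_fiberIdeal hp hb)
    | add x y hx hy =>
      obtain ⟨κ, hκ⟩ := hx
      obtain ⟨κ', hκ'⟩ := hy
      exact ⟨κ + κ', by rw [map_add, map_add, hκ, hκ', add_smul]⟩
  have htop : Submodule.span K (Set.range fun j => mk (e j)) = ⊤ := by
    rw [eq_top_iff]
    intro x _
    obtain ⟨a, rfl⟩ := Ideal.Quotient.mkₐ_surjective K _ x
    obtain ⟨v, rfl⟩ := he a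
    rw [← hmk, map_sum]
    refine Submodule.sum_mem _ fun j _ => ?_
    obtain ⟨κ, hκ⟩ := hsc (v j)
    rw [map_mul, hκ, smul_one_mul]
    exact Submodule.smul_mem _ _ (Submodule.subset_span ⟨j, rfl⟩)
  have := finrank_range_le_card (R := K) fun j => mk (e j)
  rwa [Set.finrank, htop, finrank_top, Fintype.card_fin] at this

theorem finrank_eq_of_free [Module.Finite K B] {k : ℕ} {e : Fin k → A}
    (he : ∀ x : A, ∃! v : Fin k → B, x = ∑ j, φ (v j) * e j) :
    Module.finrank K A = k * Module.finrank K B := by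
  let T : (Fin k → B) →ₗ[K] A :=
    ∑ j, LinearMap.mulRight K (e j) ∘ₗ φ.toLinearMap ∘ₗ LinearMap.proj j
  have hT : ∀ v, T v = ∑ j, φ (v j) * e j := fun v => by simp [T]
  have hbij : Function.Bijective T := by
    constructor
    · intro v w hvw
      exact (he (T v)).unique (hT v) (hvw.trans (hT w))
    · intro x
      obtain ⟨v, hv, _⟩ := he x
      exact ⟨v, by rw [hT, hv]⟩
  rw [← (LinearEquiv.ofBijective T hbij).finrank_eq]
  simp [Module.finrank_pi_fintype]

end FiberStructure

section GradedTensor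

variable {K V W X : Type*} [Field K] [AddCommGroup V] [Module K V] [AddCommGroup W] [Module K W]
  [AddCommGroup X] [Module K X] {𝒱 : ℕ → Submodule K V} {𝒲 : ℕ → Submodule K W}
  {𝒳 : ℕ → Submodule K X} {πV : ℕ → Module.End K V} {πW : ℕ → Module.End K W}
  {πX : ℕ → Module.End K X}

theorem IsGradProj.tensor_ext {Y : Type*} [AddCommGroup Y] [Module K Y] (PV : IsGradProj 𝒱 πV)
    (PW : IsGradProj 𝒲 πW) {α β : V ⊗[K] W →ₗ[K] Y}
    (h : ∀ p, ∀ v ∈ 𝒱 p, ∀ q, ∀ w ∈ 𝒲 q, α (v ⊗ₜ w) = β (v ⊗ₜ w)) : α = β := by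
  refine TensorProduct.ext (PV.ext fun p v hv => PW.ext fun q w hw => ?_)
  exact h p v hv q w hw

theorem eq_bot_of_surjective_tensor {b c : ℕ} (PV : IsGradProj 𝒱 πV) (PW : IsGradProj 𝒲 πW)
    (PX : IsGradProj 𝒳 πX) (hb : ∀ i, b < i → 𝒱 i = ⊥) (hc : ∀ i, c < i → 𝒲 i = ⊥)
    {Ψ : V ⊗[K] W →ₗ[K] X} (hsurj : Function.Surjective Ψ)
    (hΨ : ∀ p, ∀ v ∈ 𝒱 p, ∀ q, ∀ w ∈ 𝒲 q, Ψ (v ⊗ₜ w) ∈ 𝒳 (p + q)) {i : ℕ} (hi : b + c < i) :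
    𝒳 i = ⊥ := by
  have h0 : πX i ∘ₗ Ψ = 0 := by
    refine PV.tensor_ext PW fun p v hv q w hw => ?_
    rw [LinearMap.comp_apply, LinearMap.zero_apply]
    by_cases hpb : p ≤ b
    · by_cases hqc : q ≤ c
      · exact PX.ne _ _ _ (hΨ p v hv q w hw) (by omega)
      · rw [hc q (by omega), Submodule.mem_bot] at hw
        rw [hw, tmul_zero, map_zero, map_zero]
    · rw [hb p (by omega), Submodule.mem_bot] at hv
      rw [hv, zero_tmul, map_zero, map_zero]
  rw [eq_bot_iff]
  intro x hx
  obtain ⟨u, rfl⟩ := hsurj x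
  rw [Submodule.mem_bot, ← PX.same i _ hx]
  exact LinearMap.congr_fun h0 u

theorem map_weightOp_tensor {b c : ℕ} (PV : IsGradProj 𝒱 πV) (PW : IsGradProj 𝒲 πW)
    (PX : IsGradProj 𝒳 πX) (hb : ∀ i, b < i → 𝒱 i = ⊥) (hc : ∀ i, c < i → 𝒲 i = ⊥)
    (hX : ∀ i, b + c < i → 𝒳 i = ⊥) {Ψ : V ⊗[K] W →ₗ[K] X}
    (hΨ : ∀ p, ∀ v ∈ 𝒱 p, ∀ q, ∀ w ∈ 𝒲 q, Ψ (v ⊗ₜ w) ∈ 𝒳 (p + q)) (u : V ⊗[K] W) :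
    Ψ (((weightOp πV b).rTensor W + (weightOp πW c).lTensor V) u) =
      weightOp πX (b + c) (Ψ u) := by
  refine LinearMap.congr_fun (f := Ψ ∘ₗ ((weightOp πV b).rTensor W + (weightOp πW c).lTensor V))
    (g := weightOp πX (b + c) ∘ₗ Ψ) (PV.tensor_ext PW fun p v hv q w hw => ?_) u
  rw [LinearMap.comp_apply, LinearMap.comp_apply, PX.weightOp_apply hX (hΨ p v hv q w hw),
    LinearMap.add_apply, LinearMap.rTensor_tmul, LinearMap.lTensor_tmul,
    PV.weightOp_apply hb hv, PW.weightOp_apply hc hw, ← smul_tmul', tmul_smul, ← add_smul,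
    map_smul]
  congr 1
  push_cast
  ring

end GradedTensor

section Deformation

variable {K B A : Type} [Field K] [CommRing B] [Algebra K B] [CommRing A] [Algebra K A]
  {ℬ : ℕ → Submodule K B} {φ : B →ₐ[K] A}

theorem rTensor_proj_symm_mul_eq_zero {πB : ℕ → Module.End K B} (PB : IsGradProj ℬ πB)
    (hBmul : ∀ i j : ℕ, ∀ x ∈ ℬ i, ∀ y ∈ ℬ j, x * y ∈ ℬ (i + j))
    {s : A ⧸ fiberIdeal K ℬ φ →ₗ[K] A} {Ψ : B ⊗[K] (A ⧸ fiberIdeal K ℬ φ) ≃ₗ[K] A}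
    (hΨ : ∀ u, Ψ u = extendSection φ s u) {p q : ℕ} (hqp : q ≤ p) {β : B} (hβ : β ∈ ℬ p) {r : A}
    (hr : r ∈ fiberIdeal K ℬ φ) : (πB q).rTensor _ (Ψ.symm (φ β * r)) = 0 := by
  refine fiberIdeal_induction
    (motive := fun r => (πB q).rTensor _ (Ψ.symm (φ β * r)) = 0) hr ?_ ?_
  · intro p' hp' b hb a
    obtain ⟨u, rfl⟩ := Ψ.surjective a
    rw [← mul_assoc, ← map_mul, hΨ, ← extendSection_rTensor, ← hΨ, LinearEquiv.symm_apply_apply,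
      ← LinearMap.comp_apply, ← LinearMap.rTensor_comp]
    have h0 : πB q ∘ₗ LinearMap.mulLeft K (β * b) = 0 := by
      refine PB.ext fun j y hy => ?_
      exact PB.ne _ _ _ (hBmul _ _ _ (hBmul _ _ _ hβ _ hb) _ hy) (by omega)
    rw [h0, LinearMap.rTensor_zero, LinearMap.zero_apply]
  · intro x y hx hy
    rw [mul_add, map_add, map_add, hx, hy, add_zero]

theorem rTensor_proj_mul_deformation_mul {πB : ℕ → Module.End K B} (PB : IsGradProj ℬ πB)
    (hBmul : ∀ i j : ℕ, ∀ x ∈ ℬ i, ∀ y ∈ ℬ j, x * y ∈ ℬ (i + j))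
    {s : A ⧸ fiberIdeal K ℬ φ →ₗ[K] A}
    (hs : ∀ x, Ideal.Quotient.mkₐ K (fiberIdeal K ℬ φ) (s x) = x)
    {Ψ : B ⊗[K] (A ⧸ fiberIdeal K ℬ φ) ≃ₗ[K] A}
    (hΨ : ∀ u, Ψ u = extendSection φ s u) (g : A) {p q : ℕ} (hqp : q ≤ p) :
    (πB q).rTensor (A ⧸ fiberIdeal K ℬ φ) * (Ψ.symm.conj (LinearMap.mulLeft K g) -
      (LinearMap.mulLeft K (Ideal.Quotient.mkₐ K (fiberIdeal K ℬ φ) g)).lTensor B) *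
      (πB p).rTensor (A ⧸ fiberIdeal K ℬ φ) = 0 := by
  refine TensorProduct.ext' fun β x => ?_
  obtain ⟨r, hr⟩ : ∃ r, r = g * s x - s (Ideal.Quotient.mkₐ K (fiberIdeal K ℬ φ) g * x) := ⟨_, rfl⟩
  have hrI : r ∈ fiberIdeal K ℬ φ := by
    refine Ideal.Quotient.eq_zero_iff_mem.1 ?_
    change Ideal.Quotient.mkₐ K (fiberIdeal K ℬ φ) r = 0
    rw [hr, map_sub, map_mul, hs, hs, sub_self]
  have h1 : g * Ψ (πB p β ⊗ₜ x) = φ (πB p β) * r +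
      Ψ (πB p β ⊗ₜ (Ideal.Quotient.mkₐ K (fiberIdeal K ℬ φ) g * x)) := by
    rw [hΨ, hΨ, extendSection_tmul, extendSection_tmul, hr]; ring
  rw [LinearMap.zero_apply, Module.End.mul_apply, Module.End.mul_apply, LinearMap.rTensor_tmul,
    LinearMap.sub_apply, LinearMap.lTensor_tmul, LinearMap.mulLeft_apply, LinearEquiv.conj_apply,
    LinearMap.comp_apply, LinearMap.comp_apply, LinearEquiv.symm_symm, LinearEquiv.coe_coe,
    LinearEquiv.coe_coe, LinearMap.mulLeft_apply, h1, map_add, LinearEquiv.symm_apply_apply,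
    add_sub_cancel_right]
  exact rTensor_proj_symm_mul_eq_zero PB hBmul hΨ hqp (PB.mem p β) hrI

end Deformation

section DeformationParameter

variable {K U : Type*} [Field K] [CharZero K] [AddCommGroup U] [Module K U] [FiniteDimensional K U]

/-- If the raising operator `Z + S` of an `sl₂`-triple is changed to `Z + τ • D`, where `D - S` has
positive degree, then its powers remain injective on negative weight spaces for a suitable `τ`. -/
theorem IsSlTwo.exists_deformation {P : ℕ → Module.End K U} {r : ℕ}
    (hsum : ∑ p ∈ Finset.range r, P p = 1) (hsame : ∀ p, P p * P p = P p)
    (hne : ∀ p q, p ≠ q → P p * P q = 0) {Z S D f h : Module.End K U}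
    (t : IsSlTwo (Z + S) f h) (hZ : ∀ p, P (p + 1) * Z = Z * P p) (hZ0 : P 0 * Z = 0)
    (hS : ∀ p, P p * S = S * P p) (hD : ∀ p q, q ≤ p → P q * (D - S) * P p = 0)
    (hh : ∀ p, P p * h = h * P p) (C : ℕ) :
    ∃ τ : K, ∀ n ≤ C, ∀ v, h v = (-(n : K)) • v → ((Z + τ • D) ^ n) v = 0 → v = 0 := by
  have hw : ∀ (n : ℕ) v, (h + (n : K) • (1 : Module.End K U)) v = 0 ↔ h v = (-(n : K)) • v := by
    intro n v
    rw [LinearMap.add_apply, LinearMap.smul_apply, Module.End.one_apply, neg_smul,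
      add_eq_zero_iff_eq_neg]
  have hfin : ∀ n : ℕ, {τ : K | τ ≠ 0 ∧ ∃ v, v ≠ 0 ∧ (h + (n : K) • (1 : Module.End K U)) v = 0 ∧
      ((Z + τ • D) ^ n) v = 0}.Finite := by
    intro n
    have hcomm : ∀ p, P p * (h + (n : K) • 1) = (h + (n : K) • 1) * P p := fun p => by
      rw [mul_add, add_mul, hh, mul_smul_comm, smul_mul_assoc, mul_one, one_mul]
    have := finite_setOf_deformation hsum hsame hne hZ hZ0 hS hD hcomm n fun v hv h0 =>
      t.eq_zero_of_e_pow ((hw n v).1 hv) h0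
    rwa [add_sub_cancel] at this
  obtain ⟨τ, hτ⟩ := (((Finset.range (C + 1)).finite_toSet.biUnion fun n _ => hfin n).union
    (Set.finite_singleton (0 : K))).exists_notMem
  refine ⟨τ, fun n hn v hv h0 => ?_⟩
  by_contra hv0
  refine hτ ?_
  by_cases hτ0 : τ = 0
  · exact Or.inr hτ0
  · refine Or.inl (Set.mem_biUnion (x := n) ?_ ⟨hτ0, v, hv0, (hw n v).2 hv, h0⟩)
    simpa [Nat.lt_succ_iff] using hn

end DeformationParameter

section FiberTensor

variable {K B A : Type} [Field K] [CommRing B] [Algebra K B] [CommRing A] [Algebra K A]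
  {ℬ : ℕ → Submodule K B} {φ : B →ₐ[K] A}

theorem AlgHasSLP.exists_isSlTwo [CharZero K] {R : Type} [CommRing R] [Algebra K R]
    [FiniteDimensional K R]
    {ℛ : ℕ → Submodule K R} {π : ℕ → Module.End K R} (P : IsGradProj ℛ π)
    (hmul : ∀ i j : ℕ, ∀ x ∈ ℛ i, ∀ y ∈ ℛ j, x * y ∈ ℛ (i + j)) (h : AlgHasSLP K ℛ) :
    ∃ c, GradedTop K ℛ c ∧ ∃ g ∈ ℛ 1, (∀ i, ∀ v ∈ ℛ i, LinearMap.mulLeft K g v ∈ ℛ (i + 1)) ∧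
      ∃ f, IsSlTwo (LinearMap.mulLeft K g) f (weightOp π c) := by
  obtain ⟨c, hc, g, hg, hSL⟩ := h
  have he : ∀ i, ∀ v ∈ ℛ i, LinearMap.mulLeft K g v ∈ ℛ (i + 1) := by
    intro i v hv
    rw [add_comm]
    exact hmul 1 i g hg v hv
  refine ⟨c, hc, g, hg, he, P.exists_isSlTwo hc.2 he fun i hi => ?_⟩
  simpa only [LinearMap.pow_mulLeft, LinearMap.mulLeft_apply] using hSL i hi

theorem exists_extendSection_equiv [FiniteDimensional K B] [FiniteDimensional K A]
    {πB : ℕ → Module.End K B} (PB : IsGradProj ℬ πB) (hB0 : ℬ 0 = Submodule.span K {(1 : B)})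
    (hBmul : ∀ i j : ℕ, ∀ x ∈ ℬ i, ∀ y ∈ ℬ j, x * y ∈ ℬ (i + j)) {b : ℕ}
    (hb : ∀ i, b < i → ℬ i = ⊥) {s : A ⧸ fiberIdeal K ℬ φ →ₗ[K] A}
    (hs : ∀ x, Ideal.Quotient.mkₐ K (fiberIdeal K ℬ φ) (s x) = x) {k : ℕ} {e : Fin k → A}
    (he : ∀ x : A, ∃! v : Fin k → B, x = ∑ j, φ (v j) * e j) :
    ∃ Ψ : B ⊗[K] (A ⧸ fiberIdeal K ℬ φ) ≃ₗ[K] A, ∀ u, Ψ u = extendSection φ s u := by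
  have hone : (1 : B) ∈ ℬ 0 := by
    rw [hB0]
    exact Submodule.mem_span_singleton_self 1
  have hsurj := extendSection_surjective hone hBmul hb hs
  have : FiniteDimensional K (A ⧸ fiberIdeal K ℬ φ) :=
    Module.Finite.of_surjective (Ideal.Quotient.mkₐ K (fiberIdeal K ℬ φ)).toLinearMap
      (Ideal.Quotient.mkₐ_surjective K _)
  have hle : Module.finrank K (B ⊗[K] (A ⧸ fiberIdeal K ℬ φ)) ≤ Module.finrank K A := by
    rw [Module.finrank_tensorProduct, finrank_eq_of_free he, mul_comm]
    exact Nat.mul_le_mul_right _ (finrank_fiber_le PB hB0 fun x => (he x).exists)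
  have heq := le_antisymm hle (LinearMap.finrank_le_finrank_of_surjective hsurj)
  have hinj := (LinearMap.injective_iff_surjective_of_finrank_eq_finrank heq).2 hsurj
  exact ⟨LinearEquiv.ofBijective _ ⟨hinj, hsurj⟩, fun u => rfl⟩

theorem map_deformation_pow {s : A ⧸ fiberIdeal K ℬ φ →ₗ[K] A}
    {Ψ : B ⊗[K] (A ⧸ fiberIdeal K ℬ φ) ≃ₗ[K] A} (hΨ : ∀ u, Ψ u = extendSection φ s u)
    (z : B) (g : A) (τ : K) (n : ℕ) (u : B ⊗[K] (A ⧸ fiberIdeal K ℬ φ)) :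
    Ψ ((((LinearMap.mulLeft K z).rTensor (A ⧸ fiberIdeal K ℬ φ) +
      τ • Ψ.symm.conj (LinearMap.mulLeft K g) :
        Module.End K (B ⊗[K] (A ⧸ fiberIdeal K ℬ φ))) ^ n) u) = (φ z + τ • g) ^ n * Ψ u := by
  induction n with
  | zero => simp
  | succ n ih =>
    have hconj : ∀ v, Ψ (Ψ.symm.conj (LinearMap.mulLeft K g) v) = g * Ψ v := fun v => by
      simp [LinearEquiv.conj_apply]
    rw [pow_succ', Module.End.mul_apply, LinearMap.add_apply, LinearMap.smul_apply, map_add,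
      map_smul, hconj, hΨ, extendSection_rTensor, ← hΨ, ih, pow_succ', mul_assoc, add_mul,
      smul_mul_assoc]

end FiberTensor

/-- Transport of an `sl₂`-triple whose weights are given by the grading: an element of degree one
whose powers are injective on the lower half of the grading is a strong Lefschetz element. -/
theorem isAlgSLElem_of_isSlTwo {K A U : Type} [Field K] [CharZero K] [CommRing A] [Algebra K A]
    [AddCommGroup U] [Module K U] [FiniteDimensional K U] {𝒜 : ℕ → Submodule K A}
    (hAmul : ∀ i j : ℕ, ∀ x ∈ 𝒜 i, ∀ y ∈ 𝒜 j, x * y ∈ 𝒜 (i + j))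
    {πA : ℕ → Module.End K A} (PA : IsGradProj 𝒜 πA) {C : ℕ} (hC : ∀ i, C < i → 𝒜 i = ⊥)
    (Ψ : U ≃ₗ[K] A) {e f h : Module.End K U} (t : IsSlTwo e f h)
    (hw : ∀ u, Ψ (h u) = weightOp πA C (Ψ u)) {g : A} (hg : g ∈ 𝒜 1)
    (hinj : ∀ n ≤ C, ∀ u, h u = (-(n : K)) • u → g ^ n * Ψ u = 0 → u = 0) :
    IsAlgSLElem K 𝒜 C g := by
  have : FiniteDimensional K A := Module.Finite.equiv Ψ
  refine ⟨hg, fun i hi => ?_⟩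
  obtain ⟨n, rfl⟩ := Nat.exists_eq_add_of_le hi
  have hn : 2 * i + n - 2 * i = n := by omega
  have hi' : 2 * i + n - i = i + n := by omega
  rw [hn, hi']
  have hker : ∀ v ∈ 𝒜 i, g ^ n * v = 0 → v = 0 := by
    intro v hv h0
    obtain ⟨u, rfl⟩ := Ψ.surjective v
    have hu : h u = (-(n : K)) • u := by
      apply Ψ.injective
      rw [hw, PA.weightOp_apply hC hv, map_smul]
      congr 1
      push_cast
      ring
    rw [hinj n (by omega) u hu h0, map_zero]
  refine ⟨hker, ?_⟩
  have hmap : ∀ v ∈ 𝒜 i, g ^ n * v ∈ 𝒜 (i + n) := by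
    have hmap' : ∀ m, ∀ v ∈ 𝒜 i, g ^ m * v ∈ 𝒜 (i + m) := by
      intro m v hv
      induction m with
      | zero => simpa using hv
      | succ m ih =>
        rw [pow_succ', mul_assoc, ← add_assoc, add_comm]
        exact hAmul 1 _ g hg _ ih
    exact hmap' n
  have hle : Module.finrank K (𝒜 (i + n)) ≤ Module.finrank K (𝒜 i) := by
    have h1 : Module.finrank K (𝒜 (i + n)) ≤ Module.finrank K (h.eigenspace (n : K)) := by
      refine LinearMap.finrank_le_finrank_of_injective (f := Ψ.symm.toLinearMap.restrict
        (p := 𝒜 (i + n)) (q := h.eigenspace (n : K)) fun v hv => ?_) ?_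
      · rw [Module.End.mem_eigenspace_iff]
        apply Ψ.injective
        rw [hw, map_smul, LinearEquiv.coe_coe, Ψ.apply_symm_apply, PA.weightOp_apply hC hv]
        congr 1
        push_cast
        ring
      · intro x y hxy
        exact Subtype.ext (Ψ.symm.injective (congrArg Subtype.val hxy))
    have h2 : Module.finrank K (h.eigenspace (-(n : K))) ≤ Module.finrank K (𝒜 i) := by
      refine LinearMap.finrank_le_finrank_of_injective (f := Ψ.toLinearMap.restrict
        (p := h.eigenspace (-(n : K))) (q := 𝒜 i) fun u hu => ?_) ?_
      · rw [Module.End.mem_eigenspace_iff] at hu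
        refine PA.mem_of_weightOp hC ?_
        rw [LinearEquiv.coe_coe, ← hw, hu, map_smul]
        congr 1
        push_cast
        ring
      · intro x y hxy
        exact Subtype.ext (Ψ.injective (congrArg Subtype.val hxy))
    exact h1.trans ((t.finrank_le n).trans h2)
  let T : 𝒜 i →ₗ[K] 𝒜 (i + n) := (LinearMap.mulLeft K (g ^ n)).restrict hmap
  have hT : Function.Injective T := by
    rw [injective_iff_map_eq_zero]
    intro v hv
    exact Subtype.ext (hker v v.2 (congrArg Subtype.val hv))
  have hTs : Function.Surjective T :=
    (LinearMap.injective_iff_surjective_of_finrank_eq_finrank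
      (le_antisymm (LinearMap.finrank_le_finrank_of_injective hT) hle)).1 hT
  intro w hw
  obtain ⟨v, hv⟩ := hTs ⟨w, hw⟩
  exact ⟨v, v.2, congrArg Subtype.val hv⟩

/-- Theorem 6.1. Let `K` be a field of characteristic zero,
`B` a graded Artinian `K`-algebra and `A` a graded Artinian `K`-algebra which is
a finite free (equivalently, flat) `B`-module via a grade-preserving `K`-algebra
map `φ : B → A`.  If both `B` and the fiber `A/mA` have the SLP, then `A` has
the SLP. -/
theorem statement_11 {K B A : Type} [Field K] [CharZero K]
    [CommRing B] [Algebra K B] [CommRing A] [Algebra K A]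
    (ℬ : ℕ → Submodule K B) (𝒜 : ℕ → Submodule K A)
    (hB : IsGradedArtinAlg K ℬ) (hA : IsGradedArtinAlg K 𝒜)
    (φ : B →ₐ[K] A) (hgr : ∀ i : ℕ, ∀ x ∈ ℬ i, φ x ∈ 𝒜 i)
    (hfree : ∃ (k : ℕ) (e : Fin k → A),
      ∀ x : A, ∃! cvec : Fin k → B, x = ∑ j, φ (cvec j) * e j)
    (hBslp : AlgHasSLP K ℬ)
    (hfib : AlgHasSLP K (fiberGrading K ℬ φ 𝒜)) :
    AlgHasSLP K 𝒜 := by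
  obtain ⟨hBint, -, hBmul, hB0, hBfin⟩ := hB
  obtain ⟨hAint, -, hAmul, -, hAfin⟩ := hA
  obtain ⟨k, e, he⟩ := hfree
  obtain ⟨πB, PB⟩ := hBint.exists_isGradProj
  obtain ⟨πA, PA⟩ := hAint.exists_isGradProj
  obtain ⟨πF, PF, hπ⟩ := exists_fiber_isGradProj hAmul hgr PA
  have hFfin : FiniteDimensional K (A ⧸ fiberIdeal K ℬ φ) :=
    Module.Finite.of_surjective (Ideal.Quotient.mkₐ K (fiberIdeal K ℬ φ)).toLinearMap
      (Ideal.Quotient.mkₐ_surjective K _)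
  have hFmul : ∀ i j : ℕ, ∀ x ∈ fiberGrading K ℬ φ 𝒜 i, ∀ y ∈ fiberGrading K ℬ φ 𝒜 j,
      x * y ∈ fiberGrading K ℬ φ 𝒜 (i + j) := by
    rintro i j _ ⟨x, hx, rfl⟩ _ ⟨y, hy, rfl⟩
    exact ⟨x * y, hAmul i j x hx y hy, map_mul (Ideal.Quotient.mkₐ K (fiberIdeal K ℬ φ)) x y⟩
  obtain ⟨b, hb, z, hz, hzmap, fB, tB⟩ := hBslp.exists_isSlTwo PB hBmul
  obtain ⟨c, hc, _, ⟨g, hg, rfl⟩, -, fF, tF⟩ := hfib.exists_isSlTwo PF hFmul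
  obtain ⟨s, hs, hsgr⟩ := exists_graded_section PA PF hπ hc.2
  obtain ⟨Ψ, hΨ⟩ := exists_extendSection_equiv PB hB0 hBmul hb.2 hs he
  have hΨgr : ∀ p, ∀ v ∈ ℬ p, ∀ q, ∀ w ∈ fiberGrading K ℬ φ 𝒜 q,
      Ψ.toLinearMap (v ⊗ₜ w) ∈ 𝒜 (p + q) := by
    intro p v hv q w hw
    rw [LinearEquiv.coe_coe, hΨ, extendSection_tmul]
    exact hAmul p q _ (hgr p v hv) _ (hsgr q w hw)
  have hC : ∀ i, b + c < i → 𝒜 i = ⊥ := fun i hi =>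
    eq_bot_of_surjective_tensor PB PF PA hb.2 hc.2 Ψ.surjective hΨgr hi
  obtain ⟨τ, hτ⟩ := (tB.tensor tF).exists_deformation
    (P := fun p => (πB p).rTensor (A ⧸ fiberIdeal K ℬ φ)) (r := b + 1)
    (D := Ψ.symm.conj (LinearMap.mulLeft K g))
    (by
      refine TensorProduct.ext' fun β x => ?_
      rw [LinearMap.sum_apply]
      simp only [LinearMap.rTensor_tmul]
      rw [← sum_tmul, ← LinearMap.sum_apply, PB.sum_eq_one hb.2]
      rfl)
    (fun p => by rw [← LinearMap.rTensor_mul, PB.mul_self])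
    (fun p q hpq => by rw [← LinearMap.rTensor_mul, PB.mul_ne hpq, LinearMap.rTensor_zero])
    (fun p => by
      rw [← LinearMap.rTensor_mul, ← LinearMap.rTensor_mul]
      congr 1
      ext v
      exact PB.proj_succ_comm hzmap p v)
    (by
      rw [← LinearMap.rTensor_mul, ← LinearMap.rTensor_zero]
      congr 1
      ext v
      exact PB.proj_zero_comm hzmap v)
    (fun p => TensorProduct.ext' fun β x => rfl)
    (fun p q hqp => rTensor_proj_mul_deformation_mul PB hBmul hs hΨ g hqp)
    (fun p => by
      refine TensorProduct.ext' fun β x => ?_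
      simp only [Module.End.mul_apply, LinearMap.add_apply, map_add, LinearMap.rTensor_tmul,
        LinearMap.lTensor_tmul, PB.proj_weightOp hb.2]) (b + c)
  refine ⟨b + c, ⟨?_, hC⟩, φ z + τ • g, isAlgSLElem_of_isSlTwo hAmul PA hC Ψ (tB.tensor tF)
    (map_weightOp_tensor PB PF PA hb.2 hc.2 hC hΨgr)
    (add_mem (hgr 1 z hz) (Submodule.smul_mem _ _ hg)) fun n hn u hu h0 => hτ n hn u hu ?_⟩
  · obtain ⟨β, hβ, hβ0⟩ := Submodule.exists_mem_ne_zero_of_ne_bot hb.1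
    obtain ⟨x, hx, hx0⟩ := Submodule.exists_mem_ne_zero_of_ne_bot hc.1
    refine (Submodule.ne_bot_iff _).2 ⟨_, hΨgr b β hβ c x hx, ?_⟩
    rw [LinearEquiv.coe_coe, Ψ.map_ne_zero_iff]
    intro h0
    refine hβ0 ((Module.forall_dual_apply_eq_zero_iff K β).1 fun ψ => ?_)
    have h1 := congrArg (TensorProduct.lid K _ ∘ ψ.rTensor _) h0
    simpa [hx0] using h1
  · apply Ψ.injective
    rw [map_zero, ← h0, ← map_deformation_pow hΨ]
end
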